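/- Let H be a unicyclic graph and G = H_T obtained by attaching unions of complete graphs at vertices in T ⊆ V(H). Then ν(G) ≤ reg(S/I(G)) ≤ ν(G) + 1. -/

import Mathlib

open MvPolynomial

noncomputable section

namespace EdgeIdealReg

open scoped Classical

/-- The edge ideal of a simple graph, in the polynomial ring with variables the vertices. -/
def edgeIdeal (K : Type) [Field K] {V : Type} (G : SimpleGraph V) :
    Ideal (MvPolynomial V K) :=
  Ideal.span { p | ∃ u v : V, G.Adj u v ∧ p = X u * X v }

/-- The edge ideal of the induced subgraph on a set `s` of vertices, viewed inside the
polynomial ring of the ambient graph (extra variables do not change the regularity). -/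
def edgeIdealOn (K : Type) [Field K] {V : Type} (G : SimpleGraph V) (s : Set V) :
    Ideal (MvPolynomial V K) :=
  Ideal.span { p | ∃ u v : V, G.Adj u v ∧ u ∈ s ∧ v ∈ s ∧ p = X u * X v }

/-- The `r`-th symbolic power of an ideal: the intersection over all minimal primes `p` of `I`
of the contraction of `I^r` localized at `p`; concretely,
`f ∈ I^{(r)}` iff for every minimal prime `p` of `I` there is `s ∉ p` with `s * f ∈ I ^ r`. -/
def symbolicPower {R : Type} [CommRing R] (I : Ideal R) (r : ℕ) : Ideal R where
  carrier := { f | ∀ p ∈ I.minimalPrimes, ∃ s, s ∉ p ∧ s * f ∈ I ^ r }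
  zero_mem' := by
    intro p hp
    exact ⟨1, (Ideal.ne_top_iff_one p).mp hp.1.1.ne_top, by simp⟩
  add_mem' := by
    intro a b ha hb p hp
    obtain ⟨s, hs, hsa⟩ := ha p hp
    obtain ⟨t, ht, htb⟩ := hb p hp
    refine ⟨s * t, fun h => ?_, ?_⟩
    · rcases hp.1.1.mem_or_mem h with h' | h'
      · exact hs h'
      · exact ht h'
    · have : s * t * (a + b) = t * (s * a) + s * (t * b) := by ring
      rw [this]
      exact Ideal.add_mem _ (Ideal.mul_mem_left _ _ hsa) (Ideal.mul_mem_left _ _ htb)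
  smul_mem' := by
    intro c f hf p hp
    obtain ⟨s, hs, hsf⟩ := hf p hp
    refine ⟨s, hs, ?_⟩
    have : s * (c • f) = c * (s * f) := by
      simp only [smul_eq_mul]; ring
    rw [this]
    exact Ideal.mul_mem_left _ _ hsf

/-- Symbolic power with an integer exponent, with the convention `I^{(k)} = S` for `k ≤ 0`. -/
def symbolicPowerZ {R : Type} [CommRing R] (I : Ideal R) (k : ℤ) : Ideal R :=
  if k ≤ 0 then ⊤ else symbolicPower I k.toNat

/-- A graded free resolution of `S/I` over the polynomial ring `S = K[x_v]`:
`⋯ → F_{i+1} → F_i → ⋯ → F_0 = S → S/I → 0`, where `F_i` is a graded free module with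
basis elements of degrees `deg i k`, the differentials are given by matrices of homogeneous
polynomials of the appropriate degrees, the image of `F_1 → F_0 = S` is `I`, and the
complex is exact in positive homological degrees. -/
structure GradedFreeResolution {K : Type} [Field K] {σ : Type}
    (I : Ideal (MvPolynomial σ K)) where
  rank : ℕ → ℕ
  deg : (i : ℕ) → Fin (rank i) → ℕ
  rank_zero : rank 0 = 1
  deg_zero : ∀ k, deg 0 k = 0
  mat : (i : ℕ) → Matrix (Fin (rank i)) (Fin (rank (i + 1))) (MvPolynomial σ K)
  homog : ∀ i k j, mat i k j = 0 ∨
    ∃ e, deg (i + 1) j = deg i k + e ∧ (mat i k j).IsHomogeneous e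
  range_zero : ∀ f : MvPolynomial σ K,
    f ∈ I ↔ (fun _ => f) ∈ LinearMap.range (Matrix.mulVecLin (mat 0))
  isExact : ∀ i, LinearMap.ker (Matrix.mulVecLin (mat i)) =
    LinearMap.range (Matrix.mulVecLin (mat (i + 1)))

/-- The Castelnuovo–Mumford regularity of the quotient `S/I` for a homogeneous ideal `I` of
the polynomial ring: the least `d` such that some graded free resolution of `S/I` has all its
`i`-th syzygies generated in degrees `≤ d + i` (the minimal free resolution realizes the
infimum).  By convention `reg (S/S) = ⊥ = -∞`. -/

def regQuot {K : Type} [Field K] {σ : Type} (I : Ideal (MvPolynomial σ K)) : WithBot ℤ :=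
  if I = ⊤ then ⊥
  else ((sInf { d : ℤ | ∃ F : GradedFreeResolution I,
      ∀ i (k : Fin (F.rank i)), (F.deg i k : ℤ) ≤ d + i } : ℤ) : WithBot ℤ)

/-- A set of edges of `G` that forms a matching: pairwise disjoint edges. -/
def IsMatchingSet {V : Type} (G : SimpleGraph V) (M : Finset (Sym2 V)) : Prop :=
  (M : Set (Sym2 V)) ⊆ G.edgeSet ∧
    (M : Set (Sym2 V)).Pairwise fun e f => ∀ v, v ∈ e → v ∉ f

/-- An induced matching: a matching such that no two of its edges are joined by an edge
of `G`, i.e. it is the edge set of an induced subgraph. -/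
def IsInducedMatchingSet {V : Type} (G : SimpleGraph V) (M : Finset (Sym2 V)) : Prop :=
  IsMatchingSet G M ∧
    (M : Set (Sym2 V)).Pairwise fun e f => ∀ u v, u ∈ e → v ∈ f → ¬G.Adj u v

/-- The matching number `mat(G)`. -/
def matchingNumber {V : Type} (G : SimpleGraph V) : ℕ :=
  sSup { n | ∃ M, IsMatchingSet G M ∧ M.card = n }

/-- The induced matching number `ν(G)`. -/
def inducedMatchingNumber {V : Type} (G : SimpleGraph V) : ℕ :=
  sSup { n | ∃ M, IsInducedMatchingSet G M ∧ M.card = n }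

/-- `G` has an induced cycle of length `n`. -/
def HasInducedCycle {V : Type} (G : SimpleGraph V) (n : ℕ) : Prop :=
  ∃ f : ZMod n → V, Function.Injective f ∧
    ∀ i j : ZMod n, G.Adj (f i) (f j) ↔ (j = i + 1 ∨ i = j + 1)

/-- A graph is chordal if every induced cycle has length `3`. -/
def Chordal {V : Type} (G : SimpleGraph V) : Prop :=
  ∀ n, 4 ≤ n → ¬HasInducedCycle G n

/-- A graph is weakly chordal if every induced cycle in `G` and in `Gᶜ` has length at most 4. -/
def WeaklyChordal {V : Type} (G : SimpleGraph V) : Prop :=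
  (∀ n, 5 ≤ n → ¬HasInducedCycle G n) ∧ ∀ n, 5 ≤ n → ¬HasInducedCycle Gᶜ n

/-- The co-chordal cover number `cochord(G)`: the least `n` such that `n` co-chordal
subgraphs of `G` cover all the edges of `G`. -/
def cochordNumber {V : Type} (G : SimpleGraph V) : ℕ :=
  sInf { n | ∃ H : Fin n → SimpleGraph V,
    (∀ i, H i ≤ G ∧ Chordal (H i)ᶜ) ∧ ∀ e ∈ G.edgeSet, ∃ i, e ∈ (H i).edgeSet }

/-- A graph is unicyclic if it contains exactly one cycle. -/
def Unicyclic {V : Type} (G : SimpleGraph V) : Prop :=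
  ∃ (v : V) (c : G.Walk v v), c.IsCycle ∧
    ∀ (w : V) (c' : G.Walk w w), c'.IsCycle → { e | e ∈ c'.edges } = { e | e ∈ c.edges }

/-- Data exhibiting `G` as the graph `H_T` obtained from the induced subgraph on `Hset`
by attaching, at each vertex of `T ⊆ Hset`, a union of complete graphs having that vertex as
their only common vertex: a family of cliques `C i` of `G`, each meeting `Hset` exactly in
its attachment vertex `a i ∈ T`, two distinct cliques meeting in at most the common
attachment vertex, together covering all vertices outside `Hset`, and all edges of `G`
lying either inside `Hset` or inside one of the cliques. -/
structure CliqueAttachment {V : Type} (G : SimpleGraph V) (Hset T : Set V) where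
  ι : Type
  C : ι → Finset V
  a : ι → V
  a_mem_T : ∀ i, a i ∈ T
  T_sub : T ⊆ Hset
  inter_H : ∀ i, (C i : Set V) ∩ Hset = {a i}
  a_mem_C : ∀ i, a i ∈ C i
  clique : ∀ i, G.IsClique (C i)
  pairwise_inter : ∀ i j, i ≠ j → (C i : Set V) ∩ (C j : Set V) ⊆ ({a i} : Set V)
  cover : Hset ∪ (⋃ i, (C i : Set V)) = Set.univ
  edges_sub : ∀ u v, G.Adj u v → (u ∈ Hset ∧ v ∈ Hset) ∨ ∃ i, u ∈ C i ∧ v ∈ C i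

end EdgeIdealReg


namespace RegAux

open EdgeIdealReg

section Upper

variable {K : Type} [Field K] {σ : Type}

/-- Homogeneous component of degree `d` of a vector in a graded free module. -/
def comp {n : ℕ} (deg : Fin n → ℕ) (d : ℕ) (v : Fin n → MvPolynomial σ K) :
    Fin n → MvPolynomial σ K :=
  fun i => if deg i ≤ d then homogeneousComponent (d - deg i) (v i) else 0

lemma coeff_comp {n : ℕ} (deg : Fin n → ℕ) (d : ℕ) (v : Fin n → MvPolynomial σ K) (i : Fin n)
    (m : σ →₀ ℕ) :
    coeff m (comp deg d v i) = if m.degree + deg i = d then coeff m (v i) else 0 := by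
  unfold comp
  by_cases h : deg i ≤ d
  · rw [if_pos h, coeff_homogeneousComponent]
    by_cases h2 : m.degree = d - deg i
    · rw [if_pos h2, if_pos (by omega)]
    · rw [if_neg h2, if_neg (by omega)]
  · rw [if_neg h, if_neg (by omega), coeff_zero]

lemma comp_add {n : ℕ} (deg : Fin n → ℕ) (d : ℕ) (v w : Fin n → MvPolynomial σ K) :
    comp deg d (v + w) = comp deg d v + comp deg d w := by
  funext i; ext m
  simp only [coeff_comp, Pi.add_apply, coeff_add]
  split_ifs <;> simp

lemma comp_zero {n : ℕ} (deg : Fin n → ℕ) (d : ℕ) :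
    comp deg d (0 : Fin n → MvPolynomial σ K) = 0 := by
  funext i; ext m
  simp [coeff_comp]

lemma comp_sum {n : ℕ} (deg : Fin n → ℕ) (d : ℕ) {ι : Type} (s : Finset ι)
    (f : ι → Fin n → MvPolynomial σ K) :
    comp deg d (∑ k ∈ s, f k) = ∑ k ∈ s, comp deg d (f k) := by
  classical
  induction s using Finset.induction_on with
  | empty => simp [comp_zero]
  | insert a s ha ih => rw [Finset.sum_insert ha, Finset.sum_insert ha, comp_add, ih]

lemma comp_comp {n : ℕ} (deg : Fin n → ℕ) (d : ℕ) (v : Fin n → MvPolynomial σ K) :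
    comp deg d (comp deg d v) = comp deg d v := by
  funext i; ext m
  simp only [coeff_comp]
  split_ifs <;> simp

/-- A homogeneous vector of degree `d`. -/
def VHom {n : ℕ} (deg : Fin n → ℕ) (d : ℕ) (v : Fin n → MvPolynomial σ K) : Prop :=
  comp deg d v = v

lemma VHom.coeff {n : ℕ} {deg : Fin n → ℕ} {d : ℕ} {v : Fin n → MvPolynomial σ K}
    (h : VHom deg d v) {i : Fin n} {m : σ →₀ ℕ} (hm : MvPolynomial.coeff m (v i) ≠ 0) :
    m.degree + deg i = d := by
  by_contra hne
  apply hm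
  rw [← h, coeff_comp, if_neg hne]

lemma vhom_iff {n : ℕ} {deg : Fin n → ℕ} {d : ℕ} {v : Fin n → MvPolynomial σ K} :
    VHom deg d v ↔ ∀ i m, MvPolynomial.coeff m (v i) ≠ 0 → m.degree + deg i = d := by
  refine ⟨fun h i m => h.coeff, fun h => ?_⟩
  funext i; ext m
  rw [coeff_comp]
  split_ifs with h1
  · rfl
  · by_contra h2
    exact h1 (h i m (Ne.symm h2))

/-- Scalar multiples of a homogeneous vector: the components. -/
lemma comp_smul {n : ℕ} {deg : Fin n → ℕ} {c : ℕ} {b : Fin n → MvPolynomial σ K}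
    (hb : VHom deg c b) (d : ℕ) (p : MvPolynomial σ K) :
    comp deg d (p • b) =
      (if c ≤ d then homogeneousComponent (d - c) p else 0) • b := by
  classical
  funext i; ext m
  rw [coeff_comp]
  simp only [Pi.smul_apply, smul_eq_mul]
  rw [coeff_mul, coeff_mul, ← Finset.sum_filter_add_sum_filter_not _ (fun _ => m.degree + deg i = d)]
  by_cases h : m.degree + deg i = d
  · simp only [h, if_true, not_true, Finset.filter_false, Finset.sum_empty, add_zero,
      Finset.filter_true]
    apply Finset.sum_congr rfl
    rintro ⟨a, e⟩ hae
    rw [Finset.HasAntidiagonal.mem_antidiagonal] at hae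
    simp only at hae ⊢
    by_cases he : MvPolynomial.coeff e (b i) = 0
    · simp [he]
    · have h1 := hb.coeff he
      have h2 : m.degree = a.degree + e.degree := by rw [← hae, map_add]
      rw [if_pos (by omega), coeff_homogeneousComponent, if_pos (by omega)]
  · rw [if_neg h]
    symm
    apply Finset.sum_eq_zero
    rintro ⟨a, e⟩ hae
    rw [Finset.HasAntidiagonal.mem_antidiagonal] at hae
    simp only at hae ⊢
    by_cases he : MvPolynomial.coeff e (b i) = 0
    · simp [he]
    · have h1 := hb.coeff he
      have h2 : m.degree = a.degree + e.degree := by rw [← hae, map_add]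
      split_ifs with h3
      · rw [coeff_homogeneousComponent, if_neg (by omega), zero_mul]
      · simp

/-- Graded linear maps between graded free modules. -/
def GrMap {n m : ℕ} (deg : Fin n → ℕ) (deg' : Fin m → ℕ)
    (A : (Fin n → MvPolynomial σ K) →ₗ[MvPolynomial σ K] (Fin m → MvPolynomial σ K)) : Prop :=
  ∀ d v, A (comp deg d v) = comp deg' d (A v)

lemma GrMap.vhom {n m : ℕ} {deg : Fin n → ℕ} {deg' : Fin m → ℕ}
    {A : (Fin n → MvPolynomial σ K) →ₗ[MvPolynomial σ K] (Fin m → MvPolynomial σ K)}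
    (hA : GrMap deg deg' A) {d : ℕ} {v : Fin n → MvPolynomial σ K} (hv : VHom deg d v) :
    VHom deg' d (A v) := by
  unfold VHom at *
  rw [← hA, hv]

lemma GrMap.comp {n m l : ℕ} {deg : Fin n → ℕ} {deg' : Fin m → ℕ} {deg'' : Fin l → ℕ}
    {A : (Fin n → MvPolynomial σ K) →ₗ[MvPolynomial σ K] (Fin m → MvPolynomial σ K)}
    {B : (Fin m → MvPolynomial σ K) →ₗ[MvPolynomial σ K] (Fin l → MvPolynomial σ K)}
    (hB : GrMap deg' deg'' B) (hA : GrMap deg deg' A) : GrMap deg deg'' (B ∘ₗ A) := by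
  intro d v
  rw [LinearMap.comp_apply, LinearMap.comp_apply, hA, hB]

lemma GrMap.add {n m : ℕ} {deg : Fin n → ℕ} {deg' : Fin m → ℕ}
    {A B : (Fin n → MvPolynomial σ K) →ₗ[MvPolynomial σ K] (Fin m → MvPolynomial σ K)}
    (hA : GrMap deg deg' A) (hB : GrMap deg deg' B) : GrMap deg deg' (A + B) := by
  intro d v
  rw [LinearMap.add_apply, LinearMap.add_apply, hA, hB, comp_add]

lemma grMap_linearCombination {n m : ℕ} {deg : Fin n → ℕ} {deg' : Fin m → ℕ}
    (b : Fin m → Fin n → MvPolynomial σ K) (hb : ∀ k, VHom deg (deg' k) (b k)) :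
    GrMap deg' deg (Fintype.linearCombination (MvPolynomial σ K) b) := by
  intro d v
  rw [Fintype.linearCombination_apply, Fintype.linearCombination_apply, comp_sum]
  refine Finset.sum_congr rfl fun k _ => ?_
  rw [comp_smul (hb k)]
  rfl

lemma vhom_single {n : ℕ} (deg : Fin n → ℕ) (k : Fin n) :
    VHom deg (deg k) (Pi.single k (1 : MvPolynomial σ K)) := by
  classical
  rw [vhom_iff]
  intro i m hm
  by_cases hik : i = k
  · subst hik
    rw [Pi.single_eq_same, coeff_one] at hm
    have : m = 0 := by
      by_contra h
      exact hm (if_neg (Ne.symm h))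
    simp [this]
  · rw [Pi.single_eq_of_ne hik] at hm
    simp at hm

/-- One step of a resolution: a graded free cover of `N` by generators of degree at most `e`,
with the kernel satisfying `Q` with bound `e + 1`. -/
def Step (Q : ∀ n : ℕ, (Fin n → ℕ) → Submodule (MvPolynomial σ K) (Fin n → MvPolynomial σ K) →
      ℕ → Prop)
    (n : ℕ) (deg : Fin n → ℕ) (N : Submodule (MvPolynomial σ K) (Fin n → MvPolynomial σ K))
    (e : ℕ) : Prop :=
  ∃ (m : ℕ) (deg' : Fin m → ℕ)
    (A : (Fin m → MvPolynomial σ K) →ₗ[MvPolynomial σ K] (Fin n → MvPolynomial σ K)),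
    (∀ k, deg' k ≤ e) ∧ GrMap deg' deg A ∧ LinearMap.range A = N ∧
      Q m deg' (LinearMap.ker A) (e + 1)

/-- `N` has a graded free resolution with generators in the `i`-th step of degree `≤ e + i`. -/
def RegM (n : ℕ) (deg : Fin n → ℕ)
    (N : Submodule (MvPolynomial σ K) (Fin n → MvPolynomial σ K)) (e : ℕ) : Prop :=
  ∃ Q : ∀ n : ℕ, (Fin n → ℕ) → Submodule (MvPolynomial σ K) (Fin n → MvPolynomial σ K) →
      ℕ → Prop,
    Q n deg N e ∧ ∀ n deg N e, Q n deg N e → Step Q n deg N e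

lemma RegM.step {n : ℕ} {deg : Fin n → ℕ}
    {N : Submodule (MvPolynomial σ K) (Fin n → MvPolynomial σ K)} {e : ℕ}
    (h : RegM n deg N e) : Step RegM n deg N e := by
  obtain ⟨Q, h0, hQ⟩ := h
  obtain ⟨m, deg', A, h1, h2, h3, h4⟩ := hQ _ _ _ _ h0
  exact ⟨m, deg', A, h1, h2, h3, Q, h4, hQ⟩

lemma RegM.of_step {n : ℕ} {deg : Fin n → ℕ}
    {N : Submodule (MvPolynomial σ K) (Fin n → MvPolynomial σ K)} {e : ℕ}
    (h : Step RegM n deg N e) : RegM n deg N e := by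
  refine ⟨fun n deg N e => Step RegM n deg N e, h, ?_⟩
  rintro n deg N e ⟨m, deg', A, h1, h2, h3, h4⟩
  exact ⟨m, deg', A, h1, h2, h3, h4.step⟩

lemma RegM.mono {n : ℕ} {deg : Fin n → ℕ}
    {N : Submodule (MvPolynomial σ K) (Fin n → MvPolynomial σ K)} {e e' : ℕ}
    (h : RegM n deg N e) (hee : e ≤ e') : RegM n deg N e' := by
  refine ⟨fun n deg N e' => ∃ e, RegM n deg N e ∧ e ≤ e', ⟨e, h, hee⟩, ?_⟩
  rintro n deg N e' ⟨e, h, hee⟩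
  obtain ⟨m, deg', A, h1, h2, h3, h4⟩ := h.step
  exact ⟨m, deg', A, fun k => (h1 k).trans hee, h2, h3, e + 1, h4, by omega⟩

lemma RegM.comp_mem {n : ℕ} {deg : Fin n → ℕ}
    {N : Submodule (MvPolynomial σ K) (Fin n → MvPolynomial σ K)} {e : ℕ}
    (h : RegM n deg N e) (d : ℕ) {v : Fin n → MvPolynomial σ K} (hv : v ∈ N) :
    comp deg d v ∈ N := by
  obtain ⟨m, deg', A, h1, h2, h3, h4⟩ := h.step
  rw [← h3] at hv ⊢
  obtain ⟨w, rfl⟩ := hv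
  exact ⟨comp deg' d w, h2 d w⟩

lemma comp_shift {n : ℕ} (deg : Fin n → ℕ) (d : ℕ) (v : Fin n → MvPolynomial σ K) :
    comp (fun i => deg i + 1) d v = if 1 ≤ d then comp deg (d - 1) v else 0 := by
  funext i; ext m
  rw [coeff_comp]
  split_ifs with h1 h2 h3
  · rw [coeff_comp, if_pos (by omega)]
  · omega
  · rw [coeff_comp, if_neg (by omega)]
  · simp

lemma GrMap.shift {n m : ℕ} {deg : Fin n → ℕ} {deg' : Fin m → ℕ}
    {A : (Fin n → MvPolynomial σ K) →ₗ[MvPolynomial σ K] (Fin m → MvPolynomial σ K)}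
    (hA : GrMap deg deg' A) : GrMap (fun i => deg i + 1) (fun i => deg' i + 1) A := by
  intro d v
  rw [comp_shift, comp_shift]
  split_ifs
  · exact hA _ _
  · simp

lemma RegM.shift {n : ℕ} {deg : Fin n → ℕ}
    {N : Submodule (MvPolynomial σ K) (Fin n → MvPolynomial σ K)} {e : ℕ}
    (h : RegM n deg N e) : RegM n (fun i => deg i + 1) N (e + 1) := by
  refine ⟨fun n deg' N e' => ∃ deg e, RegM n deg N e ∧ deg' = (fun i => deg i + 1) ∧ e' = e + 1,
    ⟨deg, e, h, rfl, rfl⟩, ?_⟩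
  rintro n _ N _ ⟨deg, e, h, rfl, rfl⟩
  obtain ⟨m, deg', A, h1, h2, h3, h4⟩ := h.step
  exact ⟨m, fun i => deg' i + 1, A, fun k => Nat.succ_le_succ (h1 k), h2.shift, h3, deg', e + 1, h4,
    rfl, rfl⟩

/-- Inclusion of the left summand. -/
def inlMap (a b : ℕ) :
    (Fin a → MvPolynomial σ K) →ₗ[MvPolynomial σ K] (Fin (a + b) → MvPolynomial σ K) where
  toFun v := Fin.append v 0
  map_add' v w := by
    funext i
    refine Fin.addCases (fun i => ?_) (fun i => ?_) i <;> simp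
  map_smul' c v := by
    funext i
    refine Fin.addCases (fun i => ?_) (fun i => ?_) i <;> simp

/-- Projection on the left summand. -/
def fstMap (a b : ℕ) :
    (Fin (a + b) → MvPolynomial σ K) →ₗ[MvPolynomial σ K] (Fin a → MvPolynomial σ K) :=
  LinearMap.funLeft _ _ (Fin.castAdd b)

/-- Projection on the right summand. -/
def sndMap (a b : ℕ) :
    (Fin (a + b) → MvPolynomial σ K) →ₗ[MvPolynomial σ K] (Fin b → MvPolynomial σ K) :=
  LinearMap.funLeft _ _ (Fin.natAdd a)

@[simp] lemma fstMap_apply (a b : ℕ) (v : Fin (a + b) → MvPolynomial σ K) (i : Fin a) :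
    fstMap a b v i = v (Fin.castAdd b i) := rfl
@[simp] lemma sndMap_apply (a b : ℕ) (v : Fin (a + b) → MvPolynomial σ K) (i : Fin b) :
    sndMap a b v i = v (Fin.natAdd a i) := rfl
@[simp] lemma inlMap_castAdd (a b : ℕ) (v : Fin a → MvPolynomial σ K) (i : Fin a) :
    inlMap a b v (Fin.castAdd b i) = v i := by simp [inlMap]
@[simp] lemma inlMap_natAdd (a b : ℕ) (v : Fin a → MvPolynomial σ K) (i : Fin b) :
    inlMap a b v (Fin.natAdd a i) = 0 := by simp [inlMap]
@[simp] lemma fstMap_append (a b : ℕ) (v : Fin a → MvPolynomial σ K)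
    (w : Fin b → MvPolynomial σ K) : fstMap a b (Fin.append v w) = v := by
  funext i; simp
@[simp] lemma sndMap_append (a b : ℕ) (v : Fin a → MvPolynomial σ K)
    (w : Fin b → MvPolynomial σ K) : sndMap a b (Fin.append v w) = w := by
  funext i; simp
@[simp] lemma fstMap_inlMap (a b : ℕ) (v : Fin a → MvPolynomial σ K) :
    fstMap a b (inlMap a b v) = v := by funext i; simp
@[simp] lemma sndMap_inlMap (a b : ℕ) (v : Fin a → MvPolynomial σ K) :
    sndMap a b (inlMap a b v) = 0 := by funext i; simp

lemma eq_inlMap_of_snd {a b : ℕ} {v : Fin (a + b) → MvPolynomial σ K}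
    (h : sndMap a b v = 0) : v = inlMap a b (fstMap a b v) := by
  funext i
  refine Fin.addCases (fun i => ?_) (fun i => ?_) i
  · simp
  · simpa using congrFun h i

lemma grMap_inl {a b : ℕ} (da : Fin a → ℕ) (db : Fin b → ℕ) :
    GrMap (K := K) (σ := σ) da (Fin.append da db) (inlMap a b) := by
  intro d v
  funext i; ext m
  refine Fin.addCases (fun i => ?_) (fun i => ?_) i
  · simp [coeff_comp]
  · simp [coeff_comp]

lemma grMap_fst {a b : ℕ} (da : Fin a → ℕ) (db : Fin b → ℕ) :
    GrMap (K := K) (σ := σ) (Fin.append da db) da (fstMap a b) := by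
  intro d v
  funext i; ext m
  simp [coeff_comp]

lemma grMap_snd {a b : ℕ} (da : Fin a → ℕ) (db : Fin b → ℕ) :
    GrMap (K := K) (σ := σ) (Fin.append da db) db (sndMap a b) := by
  intro d v
  funext i; ext m
  simp [coeff_comp]

/-- Short exact sequence data `0 → A → B → C → 0` of graded submodules of free modules. -/
structure SES {α β γ : ℕ} (da : Fin α → ℕ) (db : Fin β → ℕ) (dc : Fin γ → ℕ)
    (A : Submodule (MvPolynomial σ K) (Fin α → MvPolynomial σ K))
    (B : Submodule (MvPolynomial σ K) (Fin β → MvPolynomial σ K))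
    (C : Submodule (MvPolynomial σ K) (Fin γ → MvPolynomial σ K))
    (f : (Fin α → MvPolynomial σ K) →ₗ[MvPolynomial σ K] (Fin β → MvPolynomial σ K))
    (g : (Fin β → MvPolynomial σ K) →ₗ[MvPolynomial σ K] (Fin γ → MvPolynomial σ K)) : Prop where
  grf : GrMap da db f
  grg : GrMap db dc g
  homB : ∀ d, ∀ v ∈ B, comp db d v ∈ B
  inj : ∀ a ∈ A, f a = 0 → a = 0
  mapA : ∀ a ∈ A, f a ∈ B
  zero : ∀ a ∈ A, g (f a) = 0
  mapB : ∀ b ∈ B, g b ∈ C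
  exB : ∀ b ∈ B, g b = 0 → ∃ a ∈ A, f a = b
  surj : ∀ c ∈ C, ∃ b ∈ B, g b = c

/-- The horseshoe lemma. -/
lemma horseshoe {α β γ : ℕ} {da : Fin α → ℕ} {db : Fin β → ℕ} {dc : Fin γ → ℕ}
    {A : Submodule (MvPolynomial σ K) (Fin α → MvPolynomial σ K)}
    {B : Submodule (MvPolynomial σ K) (Fin β → MvPolynomial σ K)}
    {C : Submodule (MvPolynomial σ K) (Fin γ → MvPolynomial σ K)}
    {f : (Fin α → MvPolynomial σ K) →ₗ[MvPolynomial σ K] (Fin β → MvPolynomial σ K)}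
    {g : (Fin β → MvPolynomial σ K) →ₗ[MvPolynomial σ K] (Fin γ → MvPolynomial σ K)}
    (h : SES da db dc A B C f g) {e : ℕ} (hA : RegM α da A e) (hC : RegM γ dc C e) :
    RegM β db B e := by
  refine ⟨fun β db B e => ∃ (α γ : ℕ) (da : Fin α → ℕ) (dc : Fin γ → ℕ)
    (A : Submodule (MvPolynomial σ K) (Fin α → MvPolynomial σ K))
    (C : Submodule (MvPolynomial σ K) (Fin γ → MvPolynomial σ K))
    (f : (Fin α → MvPolynomial σ K) →ₗ[MvPolynomial σ K] (Fin β → MvPolynomial σ K))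
    (g : (Fin β → MvPolynomial σ K) →ₗ[MvPolynomial σ K] (Fin γ → MvPolynomial σ K)),
    SES da db dc A B C f g ∧ RegM α da A e ∧ RegM γ dc C e,
    ⟨α, γ, da, dc, A, C, f, g, h, hA, hC⟩, ?_⟩
  clear h hA hC
  clear f g A B C da db dc α β γ e
  rintro β db B e ⟨α, γ, da, dc, A, C, f, g, h, hA, hC⟩
  obtain ⟨p, dp, PA, hp, grA, rA, kA⟩ := hA.step
  obtain ⟨q, dq, PC, hq, grC, rC, kC⟩ := hC.step
  have hlift : ∀ k : Fin q, ∃ b ∈ B, g b = PC (Pi.single k 1) ∧ VHom db (dq k) b := by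
    intro k
    have hc : PC (Pi.single k 1) ∈ C := by rw [← rC]; exact ⟨_, rfl⟩
    obtain ⟨b, hb, hgb⟩ := h.surj _ hc
    refine ⟨comp db (dq k) b, h.homB _ _ hb, ?_, comp_comp _ _ _⟩
    rw [h.grg, hgb, ← grC, vhom_single]
  choose b hbB hgb hbh using hlift
  set L := Fintype.linearCombination (MvPolynomial σ K) b with hL
  have hgL : ∀ v, g (L v) = PC v := by
    intro v
    have : g ∘ₗ L = PC := by
      apply LinearMap.pi_ext'
      intro k
      ext
      simp [hL, hgb, Fintype.linearCombination_apply_single]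
    rw [← this]; rfl
  have hLB : ∀ v, L v ∈ B := by
    intro v
    rw [hL, Fintype.linearCombination_apply]
    exact B.sum_mem fun k _ => B.smul_mem _ (hbB k)
  have hPA : ∀ v, PA v ∈ A := fun v => by rw [← rA]; exact ⟨v, rfl⟩
  set P := f ∘ₗ PA ∘ₗ fstMap p q + L ∘ₗ sndMap p q with hP
  have hPap : ∀ v, P v = f (PA (fstMap p q v)) + L (sndMap p q v) := fun v => rfl
  have grP : GrMap (Fin.append dp dq) db P :=
    ((h.grf.comp (grA.comp (grMap_fst dp dq)))).add
      ((grMap_linearCombination b hbh).comp (grMap_snd dp dq))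
  have hgP : ∀ v, g (P v) = PC (sndMap p q v) := by
    intro v
    rw [hPap, map_add, h.zero _ (hPA _), hgL, zero_add]
  have hPB : ∀ v, P v ∈ B := fun v => by
    rw [hPap]; exact B.add_mem (h.mapA _ (hPA _)) (hLB _)
  refine ⟨p + q, Fin.append dp dq, P, ?_, grP, ?_, p, q, dp, dq, LinearMap.ker PA,
    LinearMap.ker PC, inlMap p q, sndMap p q, ?_, kA, kC⟩
  · intro k
    refine Fin.addCases (fun i => ?_) (fun i => ?_) k
    · simpa using hp i
    · simpa using hq i
  · apply le_antisymm
    · rintro _ ⟨v, rfl⟩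
      exact hPB v
    · intro x hx
      have hgx := h.mapB x hx
      rw [← rC] at hgx
      obtain ⟨w, hw⟩ := hgx
      obtain ⟨a, ha, hfa⟩ := h.exB (x - L w) (B.sub_mem hx (hLB w)) (by
        rw [map_sub, hgL, hw, sub_self])
      rw [← rA] at ha
      obtain ⟨u, rfl⟩ := ha
      refine ⟨Fin.append u w, ?_⟩
      rw [hPap, fstMap_append, sndMap_append, hfa, sub_add_cancel]
  · refine ⟨grMap_inl _ _, grMap_snd _ _, ?_, ?_, ?_, ?_, ?_, ?_, ?_⟩
    · intro d v hv
      rw [LinearMap.mem_ker] at hv ⊢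
      rw [grP, hv, comp_zero]
    · intro a _ ha
      rw [← fstMap_inlMap p q a, ha, map_zero]
    · intro a ha
      rw [LinearMap.mem_ker] at ha ⊢
      rw [hPap, fstMap_inlMap, ha, sndMap_inlMap]; simp
    · intro a _; simp
    · intro v hv
      rw [LinearMap.mem_ker] at hv ⊢
      rw [← hgP, hv, map_zero]
    · intro v hv hs
      rw [LinearMap.mem_ker] at hv
      refine ⟨fstMap p q v, ?_, (eq_inlMap_of_snd hs).symm⟩
      rw [hPap, hs, map_zero, add_zero] at hv
      exact h.inj _ (hPA _) hv
    · intro c hc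
      rw [LinearMap.mem_ker] at hc
      obtain ⟨a, ha, hfa⟩ := h.exB (L c) (hLB c) (by rw [hgL, hc])
      rw [← rA] at ha
      obtain ⟨u, rfl⟩ := ha
      refine ⟨Fin.append (-u) c, ?_, sndMap_append _ _ _ _⟩
      rw [LinearMap.mem_ker, hPap, fstMap_append, sndMap_append, ← hfa, map_neg, map_neg,
        neg_add_cancel]

/-- The cone lemma: with `0 → A → B → C → 0` where the first map has a graded retraction
on the ambient free modules. -/
lemma cone {α β γ : ℕ} {da : Fin α → ℕ} {db : Fin β → ℕ} {dc : Fin γ → ℕ}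
    {A : Submodule (MvPolynomial σ K) (Fin α → MvPolynomial σ K)}
    {B : Submodule (MvPolynomial σ K) (Fin β → MvPolynomial σ K)}
    {C : Submodule (MvPolynomial σ K) (Fin γ → MvPolynomial σ K)}
    {f : (Fin α → MvPolynomial σ K) →ₗ[MvPolynomial σ K] (Fin β → MvPolynomial σ K)}
    {g : (Fin β → MvPolynomial σ K) →ₗ[MvPolynomial σ K] (Fin γ → MvPolynomial σ K)}
    (h : SES da db dc A B C f g)
    (r : (Fin β → MvPolynomial σ K) →ₗ[MvPolynomial σ K] (Fin α → MvPolynomial σ K))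
    (grr : GrMap db da r) (hr : ∀ a, r (f a) = a)
    {e : ℕ} (hA : RegM α da A (e + 1)) (hB : RegM β db B e) :
    RegM γ dc C e := by
  apply RegM.of_step
  obtain ⟨p, dp, PB, hp, grB, rB, kB⟩ := hB.step
  have hPB : ∀ v, PB v ∈ B := fun v => by rw [← rB]; exact ⟨v, rfl⟩
  refine ⟨p, dp, g ∘ₗ PB, hp, h.grg.comp grB, ?_, ?_⟩
  · apply le_antisymm
    · rintro _ ⟨v, rfl⟩
      exact h.mapB _ (hPB v)
    · intro c hc
      obtain ⟨b, hb, rfl⟩ := h.surj c hc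
      rw [← rB] at hb
      obtain ⟨v, rfl⟩ := hb
      exact ⟨v, rfl⟩
  · refine horseshoe (f := LinearMap.id) (g := r ∘ₗ PB) (A := LinearMap.ker PB) (C := A)
      (da := dp) (dc := da) ?_ kB hA
    refine ⟨fun d v => rfl, grr.comp grB, ?_, ?_, ?_, ?_, ?_, ?_, ?_⟩
    · intro d v hv
      rw [LinearMap.mem_ker] at hv ⊢
      rw [h.grg.comp grB, hv, comp_zero]
    · intro a _ ha; exact ha
    · intro a ha
      rw [LinearMap.mem_ker] at ha ⊢
      simp [ha]
    · intro a ha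
      rw [LinearMap.mem_ker] at ha
      simp [ha]
    · intro v hv
      obtain ⟨a, ha, hfa⟩ := h.exB (PB v) (hPB v) hv
      rw [LinearMap.comp_apply, ← hfa, hr]
      exact ha
    · intro v hv h0
      refine ⟨v, ?_, rfl⟩
      obtain ⟨a, ha, hfa⟩ := h.exB (PB v) (hPB v) hv
      rw [LinearMap.comp_apply, ← hfa, hr] at h0
      rw [LinearMap.mem_ker, ← hfa, h0, map_zero]
    · intro a ha
      have := h.mapA a ha
      rw [← rB] at this
      obtain ⟨v, hv⟩ := this
      refine ⟨v, ?_, ?_⟩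
      · rw [LinearMap.mem_ker, LinearMap.comp_apply, hv, h.zero a ha]
      · rw [LinearMap.comp_apply, hv, hr]

end Upper

end RegAux


namespace RegAux

open EdgeIdealReg

section Ideals

variable {K : Type} [Field K] {σ : Type}

/-- An ideal as a submodule of the free module of rank one. -/
def toSub (I : Ideal (MvPolynomial σ K)) :
    Submodule (MvPolynomial σ K) (Fin 1 → MvPolynomial σ K) where
  carrier := {v | v 0 ∈ I}
  add_mem' := fun ha hb => I.add_mem ha hb
  zero_mem' := I.zero_mem
  smul_mem' := fun c _ hv => I.mul_mem_left c hv

@[simp] lemma mem_toSub (I : Ideal (MvPolynomial σ K)) (v : Fin 1 → MvPolynomial σ K) :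
    v ∈ toSub I ↔ v 0 ∈ I := Iff.rfl

/-- The ideal `I` has a graded free resolution with `i`-th syzygies in degree `≤ e + i`. -/
def RegI (I : Ideal (MvPolynomial σ K)) (e : ℕ) : Prop :=
  RegM 1 (fun _ => 0) (toSub I) e

/-- State for extracting a resolution. -/
structure St (K σ : Type) [Field K] where
  n : ℕ
  deg : Fin n → ℕ
  N : Submodule (MvPolynomial σ K) (Fin n → MvPolynomial σ K)
  e : ℕ
  reg : RegM n deg N e

/-- Data of the next step of a resolution. -/
structure Nx (s : St K σ) where
  m : ℕ
  deg' : Fin m → ℕ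
  A : (Fin m → MvPolynomial σ K) →ₗ[MvPolynomial σ K] (Fin s.n → MvPolynomial σ K)
  le : ∀ k, deg' k ≤ s.e
  gr : GrMap deg' s.deg A
  range : LinearMap.range A = s.N
  reg : RegM m deg' (LinearMap.ker A) (s.e + 1)

lemma nx_nonempty (s : St K σ) : Nonempty (Nx s) := by
  obtain ⟨m, deg', A, h1, h2, h3, h4⟩ := s.reg.step
  exact ⟨⟨m, deg', A, h1, h2, h3, h4⟩⟩

/-- A choice of next step. -/
def nx (s : St K σ) : Nx s := Classical.choice (nx_nonempty s)

/-- The next state. -/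
def stNext (s : St K σ) : St K σ :=
  ⟨(nx s).m, (nx s).deg', LinearMap.ker (nx s).A, s.e + 1, (nx s).reg⟩

/-- The sequence of states. -/
def stSeq (s : St K σ) : ℕ → St K σ
  | 0 => s
  | i + 1 => stNext (stSeq s i)

lemma stSeq_e (s : St K σ) (i : ℕ) : (stSeq s i).e = s.e + i := by
  induction i with
  | zero => rfl
  | succ i ih =>
    change (stSeq s i).e + 1 = _
    rw [ih]; rfl

lemma mulVecLin_toMatrix' {m n : ℕ}
    (A : (Fin m → MvPolynomial σ K) →ₗ[MvPolynomial σ K] (Fin n → MvPolynomial σ K)) :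
    Matrix.mulVecLin (LinearMap.toMatrix' A) = A := by
  rw [← Matrix.toLin'_apply', Matrix.toLin'_toMatrix']

lemma nx_homog (s : St K σ) (k : Fin s.n) (j : Fin (nx s).m) :
    LinearMap.toMatrix' (nx s).A k j = 0 ∨ ∃ e, (nx s).deg' j = s.deg k + e ∧
      (LinearMap.toMatrix' (nx s).A k j).IsHomogeneous e := by
  classical
  have h1 := (nx s).gr.vhom (vhom_single (nx s).deg' j)
  have h2 : LinearMap.toMatrix' (nx s).A k j = (nx s).A (Pi.single j 1) k := by
    rw [LinearMap.toMatrix'_apply]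
  by_cases h0 : LinearMap.toMatrix' (nx s).A k j = 0
  · exact Or.inl h0
  · right
    rw [h2] at h0
    obtain ⟨m, hm⟩ := MvPolynomial.exists_coeff_ne_zero h0
    have h3 := h1.coeff hm
    refine ⟨m.degree, by omega, ?_⟩
    rw [h2]
    intro m' hm'
    have h4 := h1.coeff hm'
    have h5 : Finsupp.weight (1 : σ → ℕ) m' = m'.degree := by
      rw [Finsupp.degree_eq_weight_one]
      rfl
    rw [h5]
    omega

lemma nx_exact (s : St K σ) :
    LinearMap.ker (Matrix.mulVecLin (LinearMap.toMatrix' (nx s).A)) =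
    LinearMap.range (Matrix.mulVecLin (LinearMap.toMatrix' (nx (stNext s)).A)) := by
  have hr := (nx (stNext s)).range
  have h1 := mulVecLin_toMatrix' (nx s).A
  have h2 := mulVecLin_toMatrix' (nx (stNext s)).A
  rw [h1, h2, hr]
  rfl

lemma exists_resolution {I : Ideal (MvPolynomial σ K)} {e : ℕ} (h : RegI I e) :
    ∃ F : GradedFreeResolution I, ∀ i (k : Fin (F.rank (i + 1))), F.deg (i + 1) k ≤ e + i := by
  classical
  let s0 : St K σ := ⟨1, fun _ => 0, toSub I, e, h⟩
  refine ⟨⟨fun i => (stSeq s0 i).n, fun i => (stSeq s0 i).deg, rfl, fun _ => rfl,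
    fun i => LinearMap.toMatrix' (nx (stSeq s0 i)).A, ?_, ?_, ?_⟩, ?_⟩
  · intro i k j
    exact nx_homog (stSeq s0 i) k j
  · intro f
    have hr := (nx s0).range
    change f ∈ I ↔ (fun _ => f) ∈ LinearMap.range
      (Matrix.mulVecLin (LinearMap.toMatrix' (nx s0).A))
    rw [mulVecLin_toMatrix', hr]
    exact Iff.rfl
  · intro i
    exact nx_exact (stSeq s0 i)
  · intro i k
    have := (nx (stSeq s0 i)).le k
    rw [stSeq_e] at this
    exact this

lemma regI_bot (e : ℕ) : RegI (⊥ : Ideal (MvPolynomial σ K)) e := by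
  refine ⟨fun n deg N e => N = ⊥, ?_, ?_⟩
  · change toSub ⊥ = ⊥
    rw [eq_bot_iff]
    intro v hv
    rw [Submodule.mem_bot]
    funext i
    rw [Subsingleton.elim i 0]
    exact hv
  · rintro n deg N e rfl
    refine ⟨0, fun _ => 0, 0, fun k => k.elim0, ?_, by simp, ?_⟩
    · intro d v; simp [comp_zero]
    · exact Subsingleton.elim _ _

lemma regI_top : RegI (⊤ : Ideal (MvPolynomial σ K)) 0 := by
  apply RegM.of_step
  refine ⟨1, fun _ => 0, LinearMap.id, fun _ => le_rfl, fun _ _ => rfl, ?_, ?_⟩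
  · rw [LinearMap.range_id, eq_comm, eq_top_iff]
    intro v _
    trivial
  · rw [LinearMap.ker_id]
    have : (⊥ : Submodule (MvPolynomial σ K) (Fin 1 → MvPolynomial σ K)) = toSub ⊥ := by
      rw [eq_comm, eq_bot_iff]
      intro v hv
      rw [Submodule.mem_bot]
      funext i
      rw [Subsingleton.elim i 0]
      exact hv
    rw [this]
    exact regI_bot _

/-- The direct sum `J ⊕ L` inside the free module of rank two. -/
def sumSub (J L : Ideal (MvPolynomial σ K)) :
    Submodule (MvPolynomial σ K) (Fin (1 + 1) → MvPolynomial σ K) :=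
  (toSub J).comap (fstMap 1 1) ⊓ (toSub L).comap (sndMap 1 1)

lemma regM_sum {J L : Ideal (MvPolynomial σ K)} {e : ℕ} {dj dl : Fin 1 → ℕ}
    (hJ : RegM 1 dj (toSub J) e) (hL : RegM 1 dl (toSub L) e) :
    RegM (1 + 1) (Fin.append dj dl) (sumSub J L) e := by
  refine horseshoe (f := inlMap 1 1) (g := sndMap 1 1) ⟨grMap_inl _ _, grMap_snd _ _, ?_, ?_, ?_,
    ?_, ?_, ?_, ?_⟩ hJ hL
  · rintro d v ⟨h1, h2⟩
    refine ⟨?_, ?_⟩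
    · change fstMap 1 1 _ ∈ toSub J
      rw [grMap_fst]; exact hJ.comp_mem d h1
    · change sndMap 1 1 _ ∈ toSub L
      rw [grMap_snd]; exact hL.comp_mem d h2
  · intro a _ ha
    rw [← fstMap_inlMap 1 1 a, ha, map_zero]
  · intro a ha
    refine ⟨?_, ?_⟩
    · change fstMap 1 1 _ ∈ toSub J
      rwa [fstMap_inlMap]
    · change sndMap 1 1 _ ∈ toSub L
      rw [sndMap_inlMap]; exact Submodule.zero_mem _
  · intro a _; exact sndMap_inlMap _ _ _
  · rintro b ⟨_, h2⟩; exact h2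
  · rintro b ⟨h1, _⟩ hb
    exact ⟨_, h1, (eq_inlMap_of_snd hb).symm⟩
  · intro c hc
    refine ⟨Fin.append 0 c, ⟨?_, ?_⟩, sndMap_append _ _ _ _⟩
    · change fstMap 1 1 _ ∈ toSub J
      rw [fstMap_append]; exact Submodule.zero_mem _
    · change sndMap 1 1 _ ∈ toSub L
      rwa [sndMap_append]

lemma comp_X_smul {n : ℕ} (deg : Fin n → ℕ) (x : σ) (d : ℕ) (v : Fin n → MvPolynomial σ K) :
    (X x : MvPolynomial σ K) • comp (fun i => deg i + 1) d v = comp deg d ((X x : MvPolynomial σ K) • v) := by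
  classical
  funext i; ext m
  simp only [Pi.smul_apply, smul_eq_mul, coeff_comp, mul_comm (X x), coeff_mul_X']
  by_cases hx : x ∈ m.support
  · rw [if_pos hx, if_pos hx]
    have h1 : (m - Finsupp.single x 1) + Finsupp.single x 1 = m := by
      apply tsub_add_cancel_of_le
      rw [Finsupp.single_le_iff]
      exact Nat.one_le_iff_ne_zero.mpr (Finsupp.mem_support_iff.mp hx)
    have h2 : m.degree = (m - Finsupp.single x 1).degree + 1 := by
      conv_lhs => rw [← h1]
      rw [map_add, Finsupp.degree_single]
    split_ifs <;> first | rfl | omega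
  · rw [if_neg hx, if_neg hx]; simp

/-- The map `a ↦ (x a, a)`. -/
def fMap (x : σ) : (Fin 1 → MvPolynomial σ K) →ₗ[MvPolynomial σ K]
    (Fin (1 + 1) → MvPolynomial σ K) where
  toFun a := Fin.append ((X x : MvPolynomial σ K) • a) a
  map_add' v w := by
    funext i
    refine Fin.addCases (fun i => ?_) (fun i => ?_) i
    · simp only [Fin.append_left, Pi.add_apply, Pi.smul_apply, smul_add]
    · simp only [Fin.append_right, Pi.add_apply]
  map_smul' c v := by
    funext i
    refine Fin.addCases (fun i => ?_) (fun i => ?_) i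
    · simp only [Fin.append_left, Pi.smul_apply, RingHom.id_apply, smul_eq_mul]
      ring
    · simp only [Fin.append_right, Pi.smul_apply, RingHom.id_apply]

@[simp] lemma fst_fMap (x : σ) (a : Fin 1 → MvPolynomial σ K) :
    fstMap 1 1 (fMap x a) = (X x : MvPolynomial σ K) • a := fstMap_append _ _ _ _
@[simp] lemma snd_fMap (x : σ) (a : Fin 1 → MvPolynomial σ K) :
    sndMap 1 1 (fMap x a) = a := sndMap_append _ _ _ _

lemma ext_fst_snd {v w : Fin (1 + 1) → MvPolynomial σ K} (h1 : fstMap 1 1 v = fstMap 1 1 w)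
    (h2 : sndMap 1 1 v = sndMap 1 1 w) : v = w := by
  funext i
  refine Fin.addCases (fun i => ?_) (fun i => ?_) i
  · exact congrFun h1 i
  · exact congrFun h2 i

/-- The map `(a, b) ↦ a - x b`. -/
def gMap (x : σ) : (Fin (1 + 1) → MvPolynomial σ K) →ₗ[MvPolynomial σ K]
    (Fin 1 → MvPolynomial σ K) :=
  fstMap 1 1 - (X x : MvPolynomial σ K) • sndMap 1 1

lemma gMap_apply (x : σ) (v : Fin (1 + 1) → MvPolynomial σ K) :
    gMap x v = fstMap 1 1 v - (X x : MvPolynomial σ K) • sndMap 1 1 v := rfl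

lemma comp_neg {n : ℕ} (deg : Fin n → ℕ) (d : ℕ) (v : Fin n → MvPolynomial σ K) :
    comp deg d (-v) = -comp deg d v := by
  rw [eq_neg_iff_add_eq_zero, ← comp_add, neg_add_cancel, comp_zero]

/-- The splitting lemma. -/
lemma splitting {J L I : Ideal (MvPolynomial σ K)} (x : σ) {e : ℕ} (hJL : J ≤ L)
    (hx : ∀ f, X x * f ∈ J → f ∈ J)
    (hI : I = J ⊔ Ideal.span {X x} * L)
    (hJ : RegI J (e + 1)) (hL : RegI L e) : RegI I (e + 1) := by
  have hmem : ∀ c, c ∈ I ↔ ∃ a ∈ J, ∃ b ∈ L, a - X x * b = c := by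
    intro c
    rw [hI, Submodule.mem_sup]
    constructor
    · rintro ⟨a, ha, b, hb, rfl⟩
      rw [Ideal.mem_span_singleton_mul] at hb
      obtain ⟨z, hz, rfl⟩ := hb
      exact ⟨a, ha, -z, L.neg_mem hz, by ring⟩
    · rintro ⟨a, ha, b, hb, rfl⟩
      refine ⟨a, ha, X x * (-b), ?_, by ring⟩
      rw [Ideal.mem_span_singleton_mul]
      exact ⟨-b, L.neg_mem hb, rfl⟩
  have hB : RegM (1 + 1) (Fin.append (fun _ => 0) (fun _ => 0 + 1)) (sumSub J L) (e + 1) :=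
    regM_sum hJ hL.shift
  have hA : RegM 1 (fun _ => 0 + 1) (toSub J) (e + 1 + 1) := hJ.shift
  refine cone (f := fMap x) (g := gMap x) (A := toSub J) (B := sumSub J L) ?_ (sndMap 1 1)
    (grMap_snd _ _) (snd_fMap x) hA hB
  refine ⟨?_, ?_, fun d v hv => hB.comp_mem d hv, ?_, ?_, ?_, ?_, ?_, ?_⟩
  · intro d v
    apply ext_fst_snd
    · rw [fst_fMap, grMap_fst, fst_fMap]
      exact comp_X_smul _ x d v
    · rw [snd_fMap, grMap_snd, snd_fMap]
  · intro d v
    rw [gMap_apply, gMap_apply, grMap_fst, grMap_snd, comp_X_smul (fun _ => 0), sub_eq_add_neg,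
      sub_eq_add_neg, comp_add, comp_neg]
  · intro a _ h
    rw [← snd_fMap x a, h, map_zero]
  · intro a ha
    refine ⟨?_, ?_⟩
    · change fstMap 1 1 _ ∈ toSub J
      rw [fst_fMap]; exact Submodule.smul_mem _ _ ha
    · change sndMap 1 1 _ ∈ toSub L
      rw [snd_fMap]; exact hJL ha
  · intro a _
    rw [gMap_apply, fst_fMap, snd_fMap, sub_self]
  · rintro b ⟨h1, h2⟩
    rw [mem_toSub, hmem]
    exact ⟨_, h1, _, h2, rfl⟩
  · rintro b ⟨h1, h2⟩ h0
    rw [gMap_apply, sub_eq_zero] at h0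
    refine ⟨sndMap 1 1 b, ?_, ?_⟩
    · apply hx
      have h3 : fstMap 1 1 b 0 ∈ J := h1
      rw [h0] at h3
      exact h3
    · apply ext_fst_snd
      · rw [fst_fMap, h0]
      · rw [snd_fMap]
  · intro c hc
    rw [mem_toSub, hmem] at hc
    obtain ⟨a, ha, b, hb, hab⟩ := hc
    refine ⟨Fin.append (fun _ => a) (fun _ => b), ⟨?_, ?_⟩, ?_⟩
    · change fstMap 1 1 _ ∈ toSub J
      rwa [fstMap_append]
    · change sndMap 1 1 _ ∈ toSub L
      rwa [sndMap_append]
    · rw [gMap_apply, fstMap_append, sndMap_append]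
      funext i
      rw [Subsingleton.elim i 0]
      exact hab

/-- Monomial ideals: cancelling a coprime monomial. -/
lemma mono_cancel {τ : Type} (s : Set (τ →₀ ℕ)) (m0 : τ →₀ ℕ)
    (hs : ∀ m ∈ s, ∀ i, m i = 0 ∨ m0 i = 0) (f : MvPolynomial τ K)
    (h : monomial m0 (1 : K) * f ∈ Ideal.span ((fun m => monomial m (1 : K)) '' s)) :
    f ∈ Ideal.span ((fun m => monomial m (1 : K)) '' s) := by
  classical
  rw [mem_ideal_span_monomial_image] at h ⊢
  intro m hm
  have h1 : m0 + m ∈ (monomial m0 (1 : K) * f).support := by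
    rw [MvPolynomial.mem_support_iff, coeff_monomial_mul, one_mul]
    exact MvPolynomial.mem_support_iff.mp hm
  obtain ⟨t, ht, hle⟩ := h _ h1
  refine ⟨t, ht, fun i => ?_⟩
  have := hle i
  rw [Finsupp.add_apply] at this
  rcases hs t ht i with h2 | h2 <;> omega

end Ideals

end RegAux


namespace RegAux

open EdgeIdealReg

section Graph

variable {K : Type} [Field K] {V : Type}

/-- Monomial ideal with given exponents. -/
def monoI (K : Type) [Field K] {τ : Type} (s : Set (τ →₀ ℕ)) : Ideal (MvPolynomial τ K) :=
  Ideal.span ((fun m => monomial m (1 : K)) '' s)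

lemma monoI_union {τ : Type} (s t : Set (τ →₀ ℕ)) :
    monoI K (s ∪ t) = monoI K s ⊔ monoI K t := by
  unfold monoI
  rw [Set.image_union, Ideal.span_union]

lemma monoI_mono {τ : Type} {s t : Set (τ →₀ ℕ)} (h : s ⊆ t) : monoI K s ≤ monoI K t :=
  Ideal.span_mono (Set.image_mono h)

lemma monoI_le {τ : Type} {s : Set (τ →₀ ℕ)} {I : Ideal (MvPolynomial τ K)}
    (h : ∀ m ∈ s, monomial m (1 : K) ∈ I) : monoI K s ≤ I := by
  unfold monoI
  rw [Ideal.span_le]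
  rintro _ ⟨m, hm, rfl⟩
  exact h m hm

lemma mem_monoI {τ : Type} {s : Set (τ →₀ ℕ)} {m : τ →₀ ℕ} (h : m ∈ s) :
    monomial m (1 : K) ∈ monoI K s := Ideal.subset_span ⟨m, h, rfl⟩

/-- Exponents of the edges inside `W`. -/
def eset (G : SimpleGraph V) (W : Set V) : Set (V →₀ ℕ) :=
  {m | ∃ u v, G.Adj u v ∧ u ∈ W ∧ v ∈ W ∧ m = Finsupp.single u 1 + Finsupp.single v 1}

/-- Exponents of the variables in `Y`. -/
def yset (Y : Set V) : Set (V →₀ ℕ) := {m | ∃ y ∈ Y, m = Finsupp.single y 1}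

lemma monomial_edge (u v : V) :
    monomial (Finsupp.single u 1 + Finsupp.single v 1) (1 : K) = X u * X v := by
  simp [X, monomial_mul]

lemma edgeIdeal_eq (G : SimpleGraph V) : edgeIdeal K G = monoI K (eset G Set.univ) := by
  unfold edgeIdeal monoI
  congr 1
  ext p
  constructor
  · rintro ⟨u, v, h, rfl⟩
    exact ⟨_, ⟨u, v, h, trivial, trivial, rfl⟩, monomial_edge u v⟩
  · rintro ⟨_, ⟨u, v, h, -, -, rfl⟩, rfl⟩
    exact ⟨u, v, h, monomial_edge u v⟩

lemma regI_vars {G : SimpleGraph V} {W : Set V} {e : ℕ} (Y : Finset V)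
    (hYW : ∀ y ∈ Y, y ∉ W) (h : RegI (monoI K (eset G W)) (e + 1)) :
    RegI (monoI K (eset G W ∪ yset (Y : Set V))) (e + 1) := by
  classical
  induction Y using Finset.induction_on with
  | empty =>
    have : eset G W ∪ yset ((∅ : Finset V) : Set V) = eset G W := by
      simp [yset]
    rwa [this]
  | insert y Y hy ih =>
    have ih := ih fun z hz => hYW z (Finset.mem_insert_of_mem hz)
    refine splitting (J := monoI K (eset G W ∪ yset (Y : Set V))) (L := ⊤) y le_top ?_ ?_ ih
      (regI_top.mono (Nat.zero_le _))
    · intro f hf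
      refine mono_cancel _ (Finsupp.single y 1) ?_ f hf
      rintro m (⟨u, v, huv, hu, hv, rfl⟩ | ⟨z, hz, rfl⟩) i
      · by_cases hi : i = y
        · left
          have h1 : u ≠ i := by rintro rfl; exact hYW y (Finset.mem_insert_self _ _) (hi ▸ hu)
          have h2 : v ≠ i := by rintro rfl; exact hYW y (Finset.mem_insert_self _ _) (hi ▸ hv)
          simp [h1, h2]
        · right; simp [Ne.symm hi]
      · by_cases hi : i = y
        · left
          have h1 : z ≠ i := by rintro rfl; exact hy (hi ▸ hz)
          simp [h1]
        · right; simp [Ne.symm hi]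
    · have h1 : eset G W ∪ yset ((insert y Y : Finset V) : Set V) =
          (eset G W ∪ yset (Y : Set V)) ∪ {Finsupp.single y 1} := by
        ext m
        simp only [yset, Set.mem_union, Set.mem_setOf_eq, Finset.coe_insert, Set.mem_insert_iff,
          Set.mem_singleton_iff, Finset.mem_coe]
        constructor
        · rintro (h | ⟨z, rfl | hz, rfl⟩)
          · exact Or.inl (Or.inl h)
          · exact Or.inr rfl
          · exact Or.inl (Or.inr ⟨z, hz, rfl⟩)
        · rintro ((h | ⟨z, hz, rfl⟩) | rfl)
          · exact Or.inl h
          · exact Or.inr ⟨z, Or.inr hz, rfl⟩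
          · exact Or.inr ⟨y, Or.inl rfl, rfl⟩
      rw [h1, monoI_union, Ideal.mul_top]
      congr 1
      unfold monoI
      rw [Set.image_singleton]
      rfl

lemma X_mem_monoI {τ : Type} {s : Set (τ →₀ ℕ)} {y : τ} (h : Finsupp.single y 1 ∈ s) :
    (X y : MvPolynomial τ K) ∈ monoI K s := mem_monoI h

lemma X_mul_mem_span {τ : Type} {L : Ideal (MvPolynomial τ K)} (x : τ)
    {f : MvPolynomial τ K} (h : f ∈ L) : X x * f ∈ Ideal.span {(X x : MvPolynomial τ K)} * L :=
  Ideal.mul_mem_mul (Ideal.mem_span_singleton_self _) h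

lemma regI_vertex [Fintype V] {G : SimpleGraph V} {W : Set V} {x : V} (hx : x ∈ W) {e : ℕ}
    (h1 : RegI (monoI K (eset G (W \ {x}))) (e + 2))
    (h2 : RegI (monoI K (eset G {w | w ∈ W ∧ w ≠ x ∧ ¬ G.Adj x w})) (e + 1)) :
    RegI (monoI K (eset G W)) (e + 2) := by
  classical
  have h3 := regI_vars (Finset.univ.filter fun w => w ∈ W ∧ G.Adj x w) (by
    intro y hy hy'
    exact hy'.2.2 (Finset.mem_filter.mp hy).2.2) h2
  set Y := Finset.univ.filter fun w => w ∈ W ∧ G.Adj x w with hY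
  have hYm : ∀ y, y ∈ W → G.Adj x y → y ∈ (Y : Set V) := by
    intro y hy hxy
    simp [hY, hy, hxy]
  refine splitting x ?_ ?_ ?_ h1 h3
  · apply monoI_le
    rintro _ ⟨u, v, huv, hu, hv, rfl⟩
    by_cases hau : G.Adj x u
    · rw [monomial_edge]
      apply Ideal.mul_mem_right
      exact X_mem_monoI (Or.inr ⟨u, hYm u hu.1 hau, rfl⟩)
    by_cases hav : G.Adj x v
    · rw [monomial_edge]
      apply Ideal.mul_mem_left
      exact X_mem_monoI (Or.inr ⟨v, hYm v hv.1 hav, rfl⟩)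
    exact mem_monoI (Or.inl ⟨u, v, huv, ⟨hu.1, hu.2, hau⟩, ⟨hv.1, hv.2, hav⟩, rfl⟩)
  · intro f hf
    refine mono_cancel _ (Finsupp.single x 1) ?_ f hf
    rintro m ⟨u, v, huv, hu, hv, rfl⟩ i
    by_cases hi : i = x
    · left
      have h1 : u ≠ i := by rintro rfl; exact hu.2 hi
      have h2 : v ≠ i := by rintro rfl; exact hv.2 hi
      simp [h1, h2]
    · right; simp [Ne.symm hi]
  · apply le_antisymm
    · apply monoI_le
      rintro _ ⟨u, v, huv, hu, hv, rfl⟩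
      by_cases hux : u = x
      · subst hux
        apply Ideal.mem_sup_right
        rw [monomial_edge]
        exact X_mul_mem_span _ (X_mem_monoI (Or.inr ⟨v, hYm v hv huv, rfl⟩))
      by_cases hvx : v = x
      · subst hvx
        apply Ideal.mem_sup_right
        rw [monomial_edge, mul_comm (X u) (X v)]
        exact X_mul_mem_span _ (X_mem_monoI (Or.inr ⟨u, hYm u hu huv.symm, rfl⟩))
      exact Ideal.mem_sup_left (mem_monoI ⟨u, v, huv, ⟨hu, hux⟩, ⟨hv, hvx⟩, rfl⟩)
    · apply sup_le
      · apply monoI_mono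
        rintro _ ⟨u, v, huv, hu, hv, rfl⟩
        exact ⟨u, v, huv, hu.1, hv.1, rfl⟩
      · have hle : monoI K (eset G {w | w ∈ W ∧ w ≠ x ∧ ¬ G.Adj x w} ∪ yset (Y : Set V)) ≤
            Submodule.comap (LinearMap.lsmul (MvPolynomial V K) (MvPolynomial V K) (X x))
              (monoI K (eset G W)) := by
          apply monoI_le
          rintro _ (⟨u, v, huv, hu, hv, rfl⟩ | ⟨y, hy, rfl⟩)
          · change X x * _ ∈ monoI K (eset G W)
            apply Ideal.mul_mem_left
            exact mem_monoI ⟨u, v, huv, hu.1, hv.1, rfl⟩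
          · change X x * X y ∈ monoI K (eset G W)
            rw [← monomial_edge]
            have hy' := (Finset.mem_filter.mp hy).2
            exact mem_monoI ⟨x, y, hy'.2, hx, hy'.1, rfl⟩
        intro z hz
        rw [Ideal.mem_span_singleton_mul] at hz
        obtain ⟨w, hw, rfl⟩ := hz
        exact hle hw

/-- Every induced matching inside `W` has at most `n` edges. -/
def NuLE (G : SimpleGraph V) (W : Set V) (n : ℕ) : Prop :=
  ∀ M : Finset (Sym2 V), IsInducedMatchingSet G M → (∀ e ∈ M, ∀ v ∈ e, v ∈ W) → M.card ≤ n

lemma NuLE.anti {G : SimpleGraph V} {W W' : Set V} {n : ℕ} (h : NuLE G W n) (hW : W' ⊆ W) :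
    NuLE G W' n := fun M hM hM' => h M hM fun e he v hv => hW (hM' e he v hv)

lemma NuLE.insert {G : SimpleGraph V} {W : Set V} {n : ℕ} (h : NuLE G W n) {x v : V}
    (hx : x ∈ W) (hv : v ∈ W) (hxv : G.Adj x v)
    (hdom : ∀ w ∈ W, G.Adj v w → w = x ∨ G.Adj x w)
    {M : Finset (Sym2 V)} (hM : IsInducedMatchingSet G M)
    (hMW : ∀ e ∈ M, ∀ w ∈ e, w ∈ W ∧ w ≠ x ∧ ¬ G.Adj x w) : M.card + 1 ≤ n := by
  classical
  have hnot : s(x, v) ∉ M := fun hm => (hMW _ hm x (by simp)).2.1 rfl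
  have key : ∀ f ∈ M, ∀ w ∈ f, ∀ u ∈ s(x, v), u ≠ w ∧ ¬ G.Adj u w := by
    intro f hf w hw u hu
    obtain ⟨h1, h2, h3⟩ := hMW f hf w hw
    rw [Sym2.mem_iff] at hu
    rcases hu with rfl | rfl
    · exact ⟨h2.symm, h3⟩
    · refine ⟨?_, ?_⟩
      · rintro rfl; exact h3 hxv
      · intro ha
        rcases hdom w h1 ha with h | h
        · exact h2 h
        · exact h3 h
  rw [← Finset.card_insert_of_notMem hnot]
  apply h
  · refine ⟨⟨?_, ?_⟩, ?_⟩
    · intro f hf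
      rw [Finset.coe_insert, Set.mem_insert_iff] at hf
      rcases hf with rfl | hf
      · exact hxv
      · exact hM.1.1 hf
    · intro e he f hf hef w hwe hwf
      rw [Finset.coe_insert, Set.mem_insert_iff] at he hf
      rcases he with rfl | he <;> rcases hf with rfl | hf
      · exact hef rfl
      · exact (key f hf w hwf w hwe).1 rfl
      · exact (key e he w hwe w hwf).1 rfl
      · exact hM.1.2 he hf hef w hwe hwf
    · intro e he f hf hef u w hue hwf
      rw [Finset.coe_insert, Set.mem_insert_iff] at he hf
      rcases he with rfl | he <;> rcases hf with rfl | hf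
      · exact absurd rfl hef
      · exact (key f hf w hwf u hue).2
      · intro ha
        exact (key e he u hue w hwf).2 ha.symm
      · exact hM.2 he hf hef u w hue hwf
  · intro e he w hw
    rw [Finset.mem_insert] at he
    rcases he with rfl | he
    · rw [Sym2.mem_iff] at hw
      rcases hw with rfl | rfl
      · exact hx
      · exact hv
    · exact (hMW e he w hw).1

/-- Every induced subgraph on a subset of `W` with an edge has a dominated vertex. -/
def Dom (G : SimpleGraph V) (W : Set V) : Prop :=
  ∀ W' ⊆ W, (∃ u ∈ W', ∃ v ∈ W', G.Adj u v) →
    ∃ x ∈ W', ∃ v ∈ W', G.Adj x v ∧ ∀ w ∈ W', G.Adj v w → w = x ∨ G.Adj x w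

lemma regI_of_dom [Fintype V] {G : SimpleGraph V} (k : ℕ) : ∀ (W : Set V), W.ncard ≤ k →
    Dom G W → ∀ n, NuLE G W n → RegI (monoI K (eset G W)) (n + 1) := by
  classical
  induction k with
  | zero =>
    intro W hW _ n _
    have hW0 : W = ∅ := by
      rw [← Set.ncard_eq_zero]; omega
    have : monoI K (eset G W) = ⊥ := by
      rw [eq_bot_iff]
      apply monoI_le
      rintro _ ⟨u, v, _, hu, _⟩
      rw [hW0] at hu
      exact absurd hu (Set.notMem_empty _)
    rw [this]; exact regI_bot _
  | succ k ih =>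
    intro W hW hD n hn
    by_cases hE : ∃ u ∈ W, ∃ v ∈ W, G.Adj u v
    · obtain ⟨x, hx, v, hv, hxv, hdom⟩ := hD W le_rfl hE
      have hn1 : 1 ≤ n := by
        have := hn.insert hx hv hxv hdom (M := ∅)
          ⟨⟨by simp, by simp [Set.Pairwise]⟩, by simp [Set.Pairwise]⟩ (by simp)
        simpa using this
      obtain ⟨n, rfl⟩ := Nat.exists_eq_add_of_le' hn1
      have hc1 : (W \ {x}).ncard ≤ k := by
        rw [Set.ncard_diff_singleton_of_mem hx]; omega
      have hsub : {w | w ∈ W ∧ w ≠ x ∧ ¬ G.Adj x w} ⊆ W \ {x} := fun w hw => ⟨hw.1, hw.2.1⟩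
      have hc2 := (Set.ncard_le_ncard hsub (Set.toFinite _)).trans hc1
      refine regI_vertex hx (ih _ hc1 (fun W' h => hD W' (h.trans Set.diff_subset)) _
        (hn.anti Set.diff_subset)) (ih _ hc2
        (fun W' h => hD W' (h.trans (hsub.trans Set.diff_subset))) n ?_)
      intro M hM hMW
      have := hn.insert hx hv hxv hdom hM hMW
      omega
    · have : monoI K (eset G W) = ⊥ := by
        rw [eq_bot_iff]
        apply monoI_le
        rintro _ ⟨u, v, huv, hu, hv, rfl⟩
        exact absurd ⟨u, hu, v, hv, huv⟩ hE
      rw [this]; exact regI_bot _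

/-- Existence of a leaf in an acyclic graph with an edge. -/
lemma exists_leaf {α : Type} [Finite α] (H : SimpleGraph α) (hH : H.IsAcyclic) {a b : α}
    (hab : H.Adj a b) : ∃ v x, H.Adj x v ∧ ∀ w, H.Adj v w → w = x := by
  classical
  have := Fintype.ofFinite α
  let c := H.connectedComponentMk a
  have ht := hH.isTree_connectedComponent c
  have hb : b ∈ c.supp := by
    rw [SimpleGraph.ConnectedComponent.mem_supp_iff]
    exact SimpleGraph.ConnectedComponent.sound hab.symm.reachable
  have ha : a ∈ c.supp := rfl
  haveI : Nontrivial c.supp := ⟨⟨a, ha⟩, ⟨b, hb⟩, fun h => hab.ne (congrArg Subtype.val h)⟩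
  haveI : Fintype c := Fintype.ofFinite c
  obtain ⟨v, hv⟩ := SimpleGraph.IsTree.exists_vert_degree_one_of_nontrivial ht
  rw [SimpleGraph.degree_eq_one_iff_existsUnique_adj] at hv
  obtain ⟨x, hx, hu⟩ := hv
  refine ⟨v.1, x.1, hx.symm, ?_⟩
  intro w hw
  have hwc : w ∈ c.supp := by
    have : (v : α) ∈ c.supp := v.2
    rw [SimpleGraph.ConnectedComponent.mem_supp_iff] at this ⊢
    rw [← this]
    exact SimpleGraph.ConnectedComponent.sound hw.symm.reachable
  have := hu ⟨w, hwc⟩ hw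
  exact congrArg Subtype.val this

lemma dom_of_attach [Fintype V] {G : SimpleGraph V} {Hset T : Set V}
    (at' : CliqueAttachment G Hset T) (W : Set V)
    (hac : (G.induce (Hset ∩ W)).IsAcyclic) : Dom G W := by
  intro W' hW' ⟨u, hu, v, hv, huv⟩
  by_cases hcase : ∃ v ∈ W', v ∉ Hset ∧ ∃ x ∈ W', G.Adj x v
  · obtain ⟨v, hv, hvH, x, hx, hxv⟩ := hcase
    refine ⟨x, hx, v, hv, hxv, ?_⟩
    intro w hw hvw
    rcases at'.edges_sub x v hxv with h | ⟨i, hxi, hvi⟩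
    · exact absurd h.2 hvH
    rcases at'.edges_sub v w hvw with h | ⟨j, hvj, hwj⟩
    · exact absurd h.1 hvH
    have hij : i = j := by
      by_contra hne
      have h1 : v = at'.a i := at'.pairwise_inter i j hne ⟨hvi, hvj⟩
      exact hvH (h1 ▸ at'.T_sub (at'.a_mem_T i))
    subst hij
    by_cases hwx : w = x
    · exact Or.inl hwx
    · exact Or.inr (at'.clique i hxi hwj (Ne.symm hwx))
  · push Not at hcase
    have hH : ∀ p ∈ W', ∀ q ∈ W', G.Adj p q → p ∈ Hset := by
      intro p hp q hq hpq
      by_contra h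
      exact hcase p hp h q hq hpq.symm
    have hac' : (G.induce (Hset ∩ W')).IsAcyclic :=
      hac.embedding (SimpleGraph.induceHomOfLE G
        (Set.inter_subset_inter_right Hset hW'))
    obtain ⟨v', x', hadj, hun⟩ := exists_leaf _ hac'
      (a := ⟨u, hH u hu v hv huv, hu⟩) (b := ⟨v, hH v hv u hu huv.symm, hv⟩) huv
    refine ⟨x'.1, x'.2.2, v'.1, v'.2.2, hadj, ?_⟩
    intro w hw hvw
    left
    exact congrArg Subtype.val (hun ⟨w, hH w hw v' v'.2.2 hvw.symm, hw⟩ hvw)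

lemma exists_break {G : SimpleGraph V} {Hset : Set V} (huni : Unicyclic (G.induce Hset)) :
    ∃ c : V, (G.induce (Hset ∩ (Set.univ \ {c}))).IsAcyclic := by
  obtain ⟨v, c, hc, huniq⟩ := huni
  refine ⟨v.1, ?_⟩
  intro w c' hc'
  let φ := SimpleGraph.induceHomOfLE G
    (Set.inter_subset_left : Hset ∩ (Set.univ \ {v.1}) ⊆ Hset)
  have h1 : (c'.map φ.toHom).IsCycle := hc'.map φ.injective
  have h2 := huniq _ _ h1
  have h3 : ∃ z, s(v, z) ∈ c.edges := by
    cases c with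
    | nil => exact absurd rfl hc.ne_nil
    | @cons _ z _ h p => exact ⟨z, by rw [SimpleGraph.Walk.edges_cons]; exact List.mem_cons_self⟩
  obtain ⟨z, hz⟩ := h3
  have h4 : s(v, z) ∈ (c'.map φ.toHom).edges := by
    have : s(v, z) ∈ {e | e ∈ c.edges} := hz
    rw [← h2] at this
    exact this
  have h5 := SimpleGraph.Walk.fst_mem_support_of_mem_edges _ h4
  rw [SimpleGraph.Walk.support_map, List.mem_map] at h5
  obtain ⟨y, _, hy⟩ := h5
  have : y.1 = v.1 := congrArg Subtype.val hy
  exact y.2.2.2 this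

lemma regI_main [Fintype V] {G : SimpleGraph V} {Hset T : Set V}
    (huni : Unicyclic (G.induce Hset)) (at' : CliqueAttachment G Hset T) {n : ℕ}
    (hn : NuLE G Set.univ n) : RegI (edgeIdeal K G) (n + 2) := by
  obtain ⟨c, hc⟩ := exists_break huni
  have hD := dom_of_attach at' _ hc
  have hsub : {w | w ∈ Set.univ ∧ w ≠ c ∧ ¬ G.Adj c w} ⊆ Set.univ \ {c} :=
    fun w hw => ⟨hw.1, hw.2.1⟩
  rw [edgeIdeal_eq]
  refine regI_vertex (x := c) (Set.mem_univ c) ?_ ?_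
  · exact (regI_of_dom _ _ le_rfl hD n (hn.anti (Set.subset_univ _))).mono (by omega)
  · exact regI_of_dom _ _ le_rfl (fun W' h => hD W' (h.trans hsub)) n
      (hn.anti (Set.subset_univ _))

end Graph

end RegAux


namespace RegAux

open EdgeIdealReg

section Lower

variable {K : Type} [Field K] {σ : Type}

lemma exists_lift {n n' p : ℕ} {deg : Fin n → ℕ} {deg' : Fin n' → ℕ} {degP : Fin p → ℕ}
    {A : (Fin n' → MvPolynomial σ K) →ₗ[MvPolynomial σ K] (Fin n → MvPolynomial σ K)}
    {B : (Fin p → MvPolynomial σ K) →ₗ[MvPolynomial σ K] (Fin n → MvPolynomial σ K)}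
    (hA : GrMap deg' deg A) (hB : GrMap degP deg B)
    (h : ∀ k, B (Pi.single k 1) ∈ LinearMap.range A) :
    ∃ C : (Fin p → MvPolynomial σ K) →ₗ[MvPolynomial σ K] (Fin n' → MvPolynomial σ K),
      GrMap degP deg' C ∧ A ∘ₗ C = B := by
  classical
  choose x hx using h
  refine ⟨Fintype.linearCombination (MvPolynomial σ K) fun k => comp deg' (degP k) (x k),
    grMap_linearCombination _ fun k => comp_comp _ _ _, ?_⟩
  refine LinearMap.pi_ext' fun k => LinearMap.ext_ring ?_
  simp only [LinearMap.comp_apply, LinearMap.single_apply]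
  rw [Fintype.linearCombination_apply_single, one_smul, hA, hx]
  exact hB.vhom (vhom_single degP k)

lemma grMap_mulVecLin {I : Ideal (MvPolynomial σ K)} (F : GradedFreeResolution I) (i : ℕ) :
    GrMap (F.deg (i + 1)) (F.deg i) (Matrix.mulVecLin (F.mat i)) := by
  classical
  have h : Matrix.mulVecLin (F.mat i) =
      Fintype.linearCombination (MvPolynomial σ K) (fun j k => F.mat i k j) := by
    refine LinearMap.pi_ext' fun k => LinearMap.ext_ring ?_
    simp only [LinearMap.comp_apply, LinearMap.single_apply]
    rw [Fintype.linearCombination_apply_single, one_smul]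
    funext l
    simp
  rw [h]
  apply grMap_linearCombination
  intro j
  rw [vhom_iff]
  intro k m hm
  rcases F.homog i k j with h0 | ⟨e, he, hh⟩
  · rw [h0] at hm; simp at hm
  · have := hh hm
    have h5 : Finsupp.weight (1 : σ → ℕ) m = m.degree := by
      rw [Finsupp.degree_eq_weight_one]
      rfl
    rw [h5] at this
    omega

lemma grMap_smul {n : ℕ} (deg : Fin n → ℕ) {f : MvPolynomial σ K} (hf : f.IsHomogeneous 2) :
    GrMap (fun i => deg i + 1 + 1) deg (f • (LinearMap.id :
      (Fin n → MvPolynomial σ K) →ₗ[MvPolynomial σ K] (Fin n → MvPolynomial σ K))) := by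
  classical
  have h : (f • (LinearMap.id :
      (Fin n → MvPolynomial σ K) →ₗ[MvPolynomial σ K] (Fin n → MvPolynomial σ K))) =
      Fintype.linearCombination (MvPolynomial σ K)
        (fun k => f • (Pi.single k 1 : Fin n → MvPolynomial σ K)) := by
    refine LinearMap.pi_ext' fun k => LinearMap.ext_ring ?_
    simp only [LinearMap.comp_apply, LinearMap.single_apply]
    rw [Fintype.linearCombination_apply_single, one_smul]
    rfl
  rw [h]
  apply grMap_linearCombination
  intro k
  rw [vhom_iff]
  intro i m hm
  by_cases hik : i = k
  · subst hik
    rw [Pi.smul_apply, Pi.single_eq_same, smul_eq_mul, mul_one] at hm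
    have := hf hm
    have h5 : Finsupp.weight (1 : σ → ℕ) m = m.degree := by
      rw [Finsupp.degree_eq_weight_one]
      rfl
    rw [h5] at this
    omega
  · rw [Pi.smul_apply, Pi.single_eq_of_ne hik, smul_zero] at hm
    simp at hm

lemma GrMap.sub {n m : ℕ} {deg : Fin n → ℕ} {deg' : Fin m → ℕ}
    {A B : (Fin n → MvPolynomial σ K) →ₗ[MvPolynomial σ K] (Fin m → MvPolynomial σ K)}
    (hA : GrMap deg deg' A) (hB : GrMap deg deg' B) : GrMap deg deg' (A - B) := by
  intro d v
  rw [LinearMap.sub_apply, LinearMap.sub_apply, hA, hB, sub_eq_iff_eq_add, ← comp_add,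
    sub_add_cancel]

lemma mulVec_mulVec_zero {I : Ideal (MvPolynomial σ K)} (F : GradedFreeResolution I) (i : ℕ)
    (v : Fin (F.rank (i + 1 + 1)) → MvPolynomial σ K) :
    Matrix.mulVecLin (F.mat i) (Matrix.mulVecLin (F.mat (i + 1)) v) = 0 := by
  have : Matrix.mulVecLin (F.mat (i + 1)) v ∈ LinearMap.ker (Matrix.mulVecLin (F.mat i)) := by
    rw [F.isExact i]; exact ⟨v, rfl⟩
  exact this

lemma subsingleton_zero {I : Ideal (MvPolynomial σ K)} (F : GradedFreeResolution I) :
    Subsingleton (Fin (F.rank 0)) := by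
  rw [F.rank_zero]; infer_instance

/-- State of the homotopy construction at level `i`. -/
def HSt {I : Ideal (MvPolynomial σ K)} (F : GradedFreeResolution I) (f : MvPolynomial σ K)
    (i : ℕ) : Type :=
  {s : (Fin (F.rank i) → MvPolynomial σ K) →ₗ[MvPolynomial σ K]
      (Fin (F.rank (i + 1)) → MvPolynomial σ K) //
    GrMap (fun k => F.deg i k + 1 + 1) (F.deg (i + 1)) s ∧
    Matrix.mulVecLin (F.mat i) ∘ₗ s ∘ₗ Matrix.mulVecLin (F.mat i) =
      f • Matrix.mulVecLin (F.mat i)}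

lemma homotopy_step {I : Ideal (MvPolynomial σ K)} (F : GradedFreeResolution I)
    {f : MvPolynomial σ K} (hf2 : f.IsHomogeneous 2) (i : ℕ) (s : HSt F f i) :
    ∃ t : HSt F f (i + 1), Matrix.mulVecLin (F.mat (i + 1)) ∘ₗ t.1 =
      f • LinearMap.id - s.1 ∘ₗ Matrix.mulVecLin (F.mat i) := by
  obtain ⟨C, hC1, hC2⟩ := exists_lift (grMap_mulVecLin F (i + 1))
    (GrMap.sub (grMap_smul (F.deg (i + 1)) hf2)
      (GrMap.comp s.2.1 (grMap_mulVecLin F i).shift.shift)) (by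
    intro k
    rw [← F.isExact i, LinearMap.mem_ker]
    have := LinearMap.congr_fun s.2.2 (Pi.single k 1)
    simp only [LinearMap.comp_apply, LinearMap.smul_apply] at this
    simp only [LinearMap.comp_apply, LinearMap.smul_apply, LinearMap.sub_apply, map_sub,
      map_smul, LinearMap.id_apply]
    rw [this, sub_self])
  refine ⟨⟨C, hC1, ?_⟩, hC2⟩
  ext1 v
  have := LinearMap.congr_fun hC2
  simp only [LinearMap.comp_apply, LinearMap.smul_apply, LinearMap.sub_apply,
    LinearMap.id_apply] at this
  refine LinearMap.ext fun x => ?_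
  simp only [LinearMap.comp_apply, LinearMap.smul_apply]
  rw [this, mulVec_mulVec_zero, map_zero, sub_zero]

lemma homotopy_zero {I : Ideal (MvPolynomial σ K)} (F : GradedFreeResolution I)
    {f : MvPolynomial σ K} (hf : f ∈ I) (hf2 : f.IsHomogeneous 2) :
    ∃ t : HSt F f 0, Matrix.mulVecLin (F.mat 0) ∘ₗ t.1 = f • LinearMap.id := by
  have := subsingleton_zero F
  obtain ⟨C, hC1, hC2⟩ := exists_lift (grMap_mulVecLin F 0) (grMap_smul (F.deg 0) hf2) (by
    intro k
    have h := (F.range_zero f).mp hf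
    convert h using 1
    funext l
    rw [Subsingleton.elim l k]
    simp)
  refine ⟨⟨C, hC1, ?_⟩, hC2⟩
  rw [← LinearMap.comp_assoc, hC2]
  rfl

/-- The homotopy for multiplication by `f`. -/
def hSeq {I : Ideal (MvPolynomial σ K)} (F : GradedFreeResolution I)
    {f : MvPolynomial σ K} (hf : f ∈ I) (hf2 : f.IsHomogeneous 2) : ∀ i, HSt F f i
  | 0 => (homotopy_zero F hf hf2).choose
  | i + 1 => (homotopy_step F hf2 i (hSeq F hf hf2 i)).choose

lemma exists_homotopy {I : Ideal (MvPolynomial σ K)} (F : GradedFreeResolution I)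
    {f : MvPolynomial σ K} (hf : f ∈ I) (hf2 : f.IsHomogeneous 2) :
    ∃ s : ∀ i, (Fin (F.rank i) → MvPolynomial σ K) →ₗ[MvPolynomial σ K]
        (Fin (F.rank (i + 1)) → MvPolynomial σ K),
      (∀ i, GrMap (fun k => F.deg i k + 1 + 1) (F.deg (i + 1)) (s i)) ∧
      (∀ v, Matrix.mulVecLin (F.mat 0) (s 0 v) = f • v) ∧
      ∀ i v, Matrix.mulVecLin (F.mat (i + 1)) (s (i + 1) v) =
        f • v - s i (Matrix.mulVecLin (F.mat i) v) := by
  refine ⟨fun i => (hSeq F hf hf2 i).1, fun i => (hSeq F hf hf2 i).2.1, ?_, ?_⟩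
  · intro v
    exact LinearMap.congr_fun (homotopy_zero F hf hf2).choose_spec v
  · intro i v
    exact LinearMap.congr_fun (homotopy_step F hf2 i (hSeq F hf hf2 i)).choose_spec v

lemma coord_mem {R : Type} [CommRing R] {n m : ℕ} (A : (Fin n → R) →ₗ[R] (Fin m → R))
    {L : Ideal R} {v : Fin n → R} (hv : ∀ i, v i ∈ L) (j : Fin m) : A v j ∈ L := by
  classical
  rw [LinearMap.pi_apply_eq_sum_univ A v, Finset.sum_apply]
  refine Ideal.sum_mem _ fun i _ => ?_
  rw [Pi.smul_apply, smul_eq_mul]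
  exact Ideal.mul_mem_right _ _ (hv i)

/-- The sequence of test elements. -/
def wSeq {I : Ideal (MvPolynomial σ K)} (F : GradedFreeResolution I)
    (s : ℕ → ∀ i, (Fin (F.rank i) → MvPolynomial σ K) →ₗ[MvPolynomial σ K]
        (Fin (F.rank (i + 1)) → MvPolynomial σ K)) :
    ∀ k, Fin (F.rank k) → MvPolynomial σ K
  | 0 => fun _ => 1
  | k + 1 => s k k (wSeq F s k)

lemma exists_w {I : Ideal (MvPolynomial σ K)} (F : GradedFreeResolution I)
    (f : ℕ → MvPolynomial σ K) (hf : ∀ k, f k ∈ I) (hf2 : ∀ k, (f k).IsHomogeneous 2) :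
    ∃ w : ∀ k, Fin (F.rank k) → MvPolynomial σ K,
      (∀ i, w 0 i = 1) ∧ (∀ k, VHom (F.deg k) (2 * k) (w k)) ∧
      ∀ k i, Matrix.mulVecLin (F.mat k) (w (k + 1)) i - f k * w k i ∈
        Ideal.span (f '' {j | j < k}) := by
  choose s h1 h2 h3 using fun k => exists_homotopy F (hf k) (hf2 k)
  refine ⟨wSeq F s, fun _ => rfl, ?_, ?_⟩
  · intro k
    induction k with
    | zero =>
      rw [vhom_iff]
      intro i m hm
      have : coeff m (1 : MvPolynomial σ K) ≠ 0 := hm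
      classical
      rw [coeff_one] at this
      have hm0 : 0 = m := by
        by_contra h
        rw [if_neg h] at this
        exact this rfl
      rw [← hm0, F.deg_zero]; simp
    | succ k ih =>
      refine (h1 k k).vhom ?_
      rw [vhom_iff] at ih ⊢
      intro i m hm
      have := ih i m hm
      omega
  · intro k
    induction k with
    | zero =>
      intro i
      have : Matrix.mulVecLin (F.mat 0) (wSeq F s (0 + 1)) = f 0 • wSeq F s 0 := h2 0 _
      rw [this, Pi.smul_apply, smul_eq_mul, sub_self]
      exact zero_mem _
    | succ k ih =>
      intro i
      have : Matrix.mulVecLin (F.mat (k + 1)) (wSeq F s (k + 1 + 1)) =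
        f (k + 1) • wSeq F s (k + 1) -
          s (k + 1) k (Matrix.mulVecLin (F.mat k) (wSeq F s (k + 1))) := h3 (k + 1) k _
      rw [this, Pi.sub_apply, Pi.smul_apply, smul_eq_mul, sub_sub_cancel_left, neg_mem_iff]
      apply coord_mem
      intro l
      have h := ih l
      rw [← sub_add_cancel (Matrix.mulVecLin (F.mat k) (wSeq F s (k + 1)) l)
        (f k * wSeq F s k l)]
      refine Ideal.add_mem _ (Ideal.span_mono (Set.image_mono ?_) h) (Ideal.mul_mem_right _ _
        (Ideal.subset_span ⟨k, Nat.lt_succ_self k, rfl⟩))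
      intro j hj
      exact Nat.lt_succ_of_lt hj

/-- The ideal generated by the squares of the variables in `s`. -/
def sqI (K : Type) [Field K] (s : Set ℕ) : Ideal (MvPolynomial ℕ K) :=
  monoI K ((fun j => Finsupp.single j 2) '' s)

lemma sqI_mono {s t : Set ℕ} (h : s ⊆ t) : sqI K s ≤ sqI K t := monoI_mono (Set.image_mono h)

lemma sq_mem_sqI {s : Set ℕ} {j : ℕ} (h : j ∈ s) :
    monomial (Finsupp.single j 2) (1 : K) ∈ sqI K s := mem_monoI ⟨j, h, rfl⟩

lemma sqI_cancel {s : Set ℕ} {k : ℕ} (hk : k ∉ s) {f : MvPolynomial ℕ K}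
    (h : monomial (Finsupp.single k 2) (1 : K) * f ∈ sqI K s) : f ∈ sqI K s := by
  refine mono_cancel _ (Finsupp.single k 2) ?_ f h
  rintro _ ⟨j, hj, rfl⟩ i
  by_cases hi : i = k
  · left
    have : j ≠ i := by rintro rfl; exact hk (hi ▸ hj)
    simp [this]
  · right; simp [Ne.symm hi]

lemma sqI_const {s : Set ℕ} {f : MvPolynomial ℕ K} (h : f ∈ sqI K s) :
    constantCoeff f = 0 := by
  have : sqI K s ≤ RingHom.ker (constantCoeff (σ := ℕ) (R := K)) := by
    apply monoI_le
    rintro _ ⟨j, -, rfl⟩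
    rw [RingHom.mem_ker, constantCoeff_monomial, if_neg]
    intro h
    have := DFunLike.congr_fun h j
    simp at this
  exact this h

lemma sqI_split {ν k : ℕ} {f : MvPolynomial ℕ K} (h : f ∈ sqI K {j | k ≤ j ∧ j < ν}) :
    ∃ a, f - monomial (Finsupp.single k 2) (1 : K) * a ∈ sqI K {j | k + 1 ≤ j ∧ j < ν} := by
  have hle : sqI K {j | k ≤ j ∧ j < ν} ≤
      Ideal.span {monomial (Finsupp.single k 2) (1 : K)} ⊔ sqI K {j | k + 1 ≤ j ∧ j < ν} := by
    apply monoI_le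
    rintro _ ⟨j, ⟨h1, h2⟩, rfl⟩
    by_cases hj : j = k
    · subst hj
      exact Ideal.mem_sup_left (Ideal.mem_span_singleton_self _)
    · exact Ideal.mem_sup_right (sq_mem_sqI ⟨by omega, h2⟩)
  obtain ⟨y, hy, z, hz, hyz⟩ := Submodule.mem_sup.mp (hle h)
  rw [Ideal.mem_span_singleton'] at hy
  obtain ⟨a, rfl⟩ := hy
  refine ⟨a, ?_⟩
  rw [← hyz, mul_comm a, add_sub_cancel_left]
  exact hz

lemma lower_core {I : Ideal (MvPolynomial σ K)} (F : GradedFreeResolution I) (ν : ℕ)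
    (f : ℕ → MvPolynomial σ K) (hf : ∀ k, f k ∈ I) (hf2 : ∀ k, (f k).IsHomogeneous 2)
    (φ : MvPolynomial σ K →+* MvPolynomial ℕ K)
    (hφc : ∀ p, constantCoeff (φ p) = constantCoeff p)
    (hφ : ∀ k < ν, φ (f k) = monomial (Finsupp.single k 2) 1)
    (hI : ∀ p ∈ I, φ p ∈ sqI K {j | j < ν}) : ∃ i, F.deg ν i = 2 * ν := by
  classical
  have hsub := subsingleton_zero F
  obtain ⟨w, hw0, hw1, hw2⟩ := exists_w F f hf hf2
  have main : ∀ k ≤ ν, ∃ a : Fin (F.rank k) → MvPolynomial ℕ K,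
      (∀ j, ∑ i, a i * φ (F.mat k i j) ∈ sqI K {j | k ≤ j ∧ j < ν}) ∧
      constantCoeff (∑ i, a i * φ (w k i)) = 1 := by
    intro k
    induction k with
    | zero =>
      intro _
      refine ⟨fun _ => 1, ?_, ?_⟩
      · intro j
        refine Ideal.sum_mem _ fun i _ => Ideal.mul_mem_left _ _ ?_
        have : F.mat 0 i j ∈ I := by
          rw [F.range_zero]
          refine ⟨Pi.single j 1, ?_⟩
          funext l
          rw [Subsingleton.elim i l]
          simp
        have hs : {j | j < ν} ⊆ {j | 0 ≤ j ∧ j < ν} := fun l hl => ⟨Nat.zero_le _, hl⟩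
        exact sqI_mono hs (hI _ this)
      · simp [hw0, F.rank_zero]
    | succ k ih =>
      intro hk
      obtain ⟨a, ha1, ha2⟩ := ih (by omega)
      choose b hb using fun j => sqI_split (ha1 j)
      refine ⟨b, ?_, ?_⟩
      · intro l
        refine sqI_cancel (k := k) (by simp) ?_
        have hz : ∑ j, (∑ i, a i * φ (F.mat k i j)) * φ (F.mat (k + 1) j l) = 0 := by
          have h0 : ∀ i, ∑ j, F.mat k i j * F.mat (k + 1) j l = 0 := by
            intro i
            have := congrFun (mulVec_mulVec_zero F k (Pi.single l 1)) i
            simpa [Matrix.mulVec, dotProduct] using this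
          calc _ = ∑ i, a i * φ (∑ j, F.mat k i j * F.mat (k + 1) j l) := by
                simp only [Finset.sum_mul, map_sum, map_mul, Finset.mul_sum]
                rw [Finset.sum_comm]
                refine Finset.sum_congr rfl fun i _ => Finset.sum_congr rfl fun j _ => by ring
            _ = 0 := by simp [h0]
        have he : monomial (Finsupp.single k 2) (1 : K) * ∑ i, b i * φ (F.mat (k + 1) i l) =
            - ∑ j, (∑ i, a i * φ (F.mat k i j) - monomial (Finsupp.single k 2) (1 : K) * b j) *
              φ (F.mat (k + 1) j l) := by
          simp only [sub_mul, Finset.sum_sub_distrib]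
          rw [hz, zero_sub, neg_neg, Finset.mul_sum]
          exact Finset.sum_congr rfl fun j _ => by ring
        rw [he, neg_mem_iff]
        exact Ideal.sum_mem _ fun j _ => Ideal.mul_mem_right _ _ (hb j)
      · rw [← ha2, ← sub_eq_zero, ← map_sub]
        refine sqI_const (s := {j | j ≠ k ∧ j < ν}) (sqI_cancel (k := k) (by simp) ?_)
        have hz : ∑ j, (∑ i, a i * φ (F.mat k i j)) * φ (w (k + 1) j) =
            ∑ i, a i * φ (Matrix.mulVecLin (F.mat k) (w (k + 1)) i) := by
          simp only [Matrix.mulVecLin_apply, Matrix.mulVec, dotProduct, Finset.sum_mul, map_sum,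
            map_mul, Finset.mul_sum]
          rw [Finset.sum_comm]
          refine Finset.sum_congr rfl fun i _ => Finset.sum_congr rfl fun j _ => by ring
        have he : monomial (Finsupp.single k 2) (1 : K) *
              (∑ i, b i * φ (w (k + 1) i) - ∑ i, a i * φ (w k i)) =
            ∑ i, a i * φ (Matrix.mulVecLin (F.mat k) (w (k + 1)) i - f k * w k i) -
            ∑ j, (∑ i, a i * φ (F.mat k i j) - monomial (Finsupp.single k 2) (1 : K) * b j) *
              φ (w (k + 1) j) := by
          simp only [sub_mul, mul_sub, map_sub, map_mul, Finset.sum_sub_distrib]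
          rw [hz, hφ k (by omega), Finset.mul_sum, Finset.mul_sum]
          have e1 : ∑ j, monomial (Finsupp.single k 2) (1 : K) * b j * φ (w (k + 1) j) =
              ∑ j, monomial (Finsupp.single k 2) (1 : K) * (b j * φ (w (k + 1) j)) :=
            Finset.sum_congr rfl fun j _ => by ring
          have e2 : ∑ j, a j * (monomial (Finsupp.single k 2) (1 : K) * φ (w k j)) =
              ∑ j, monomial (Finsupp.single k 2) (1 : K) * (a j * φ (w k j)) :=
            Finset.sum_congr rfl fun j _ => by ring
          rw [e1, e2]
          ring
        rw [he]
        have hs : {j | k + 1 ≤ j ∧ j < ν} ⊆ {j | j ≠ k ∧ j < ν} := fun l hl =>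
          ⟨by have := hl.1; omega, hl.2⟩
        refine Ideal.sub_mem _ (Ideal.sum_mem _ fun i _ => Ideal.mul_mem_left _ _ ?_)
          (Ideal.sum_mem _ fun j _ => Ideal.mul_mem_right _ _
            (sqI_mono hs (hb j)))
        · have hle : Ideal.span (f '' {j | j < k}) ≤
              Ideal.comap φ (sqI K {j | j ≠ k ∧ j < ν}) := by
            rw [Ideal.span_le]
            rintro _ ⟨j, hj, rfl⟩
            have hj' : j < k := hj
            rw [SetLike.mem_coe, Ideal.mem_comap]
            rw [hφ j (by omega)]
            exact sq_mem_sqI ⟨by omega, by omega⟩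
          exact hle (hw2 k i)
  obtain ⟨a, -, ha⟩ := main ν le_rfl
  by_contra! hcon
  rw [map_sum, Finset.sum_eq_zero] at ha
  · exact zero_ne_one ha
  · intro i _
    rw [map_mul, hφc]
    by_contra hne
    have : coeff 0 (w ν i) ≠ 0 := fun h => hne (by
      rw [← constantCoeff_eq] at h
      rw [h, mul_zero])
    have h := (hw1 ν).coeff this
    exact hcon i (by simpa using h)

lemma lower_graph {V : Type} {G : SimpleGraph V} (F : GradedFreeResolution (edgeIdeal K G))
    {M : Finset (Sym2 V)} (hM : IsInducedMatchingSet G M) :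
    ∃ i, F.deg M.card i = 2 * M.card := by
  classical
  have hex : ∀ k : Fin M.card, ∃ u v, (M.equivFin.symm k).1 = s(u, v) := fun k => by
    induction (M.equivFin.symm k).1 using Sym2.ind with
    | _ x y => exact ⟨x, y, rfl⟩
  choose u v huv using hex
  have hmem : ∀ k w, (w = u k ∨ w = v k) ↔ w ∈ (M.equivFin.symm k).1 := by
    intro k w
    rw [huv, Sym2.mem_iff]
  have hne : ∀ k l : Fin M.card, k ≠ l → (M.equivFin.symm k).1 ≠ (M.equivFin.symm l).1 := by
    intro k l hkl h
    exact hkl (M.equivFin.symm.injective (Subtype.ext h))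
  have hdisj : ∀ k l : Fin M.card, k ≠ l → ∀ w, (w = u k ∨ w = v k) → ¬ (w = u l ∨ w = v l) := by
    intro k l hkl w hk hl
    rw [hmem] at hk hl
    exact hM.1.2 (M.equivFin.symm k).2 (M.equivFin.symm l).2 (hne k l hkl) w hk hl
  have hnadj : ∀ k l : Fin M.card, k ≠ l → ∀ p q, (p = u k ∨ p = v k) → (q = u l ∨ q = v l) →
      ¬ G.Adj p q := by
    intro k l hkl p q hk hl
    rw [hmem] at hk hl
    exact hM.2 (M.equivFin.symm k).2 (M.equivFin.symm l).2 (hne k l hkl) p q hk hl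
  have hadj : ∀ k, G.Adj (u k) (v k) := by
    intro k
    have := hM.1.1 (M.equivFin.symm k).2
    rw [huv] at this
    exact this
  let θ : V → MvPolynomial ℕ K := fun w =>
    ∑ k : Fin M.card, if w = u k ∨ w = v k then X (k : ℕ) else 0
  have hθ : ∀ k w, (w = u k ∨ w = v k) → θ w = X (k : ℕ) := by
    intro k w hw
    change ∑ l : Fin M.card, (if w = u l ∨ w = v l then X (l : ℕ) else 0) = _
    rw [Finset.sum_eq_single k]
    · rw [if_pos hw]
    · intro l _ hl
      rw [if_neg (hdisj k l (Ne.symm hl) w hw)]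
    · simp
  have hsq : ∀ k : ℕ, (X k * X k : MvPolynomial ℕ K) = monomial (Finsupp.single k 2) 1 := by
    intro k
    rw [← sq, X_pow_eq_monomial]
  refine lower_core F M.card
    (fun n => if h : n < M.card then X (u ⟨n, h⟩) * X (v ⟨n, h⟩) else 0) ?_ ?_
    (aeval θ : MvPolynomial V K →ₐ[K] MvPolynomial ℕ K).toRingHom ?_ ?_ ?_
  · intro k
    split_ifs with h
    · exact Ideal.subset_span ⟨_, _, hadj ⟨k, h⟩, rfl⟩
    · exact zero_mem _
  · intro k
    split_ifs with h
    · exact (isHomogeneous_X K _).mul (isHomogeneous_X K _)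
    · exact isHomogeneous_zero _ _ _
  · intro p
    have hc : ((constantCoeff (σ := ℕ) (R := K)).comp
        (aeval θ : MvPolynomial V K →ₐ[K] MvPolynomial ℕ K).toRingHom) = constantCoeff := by
      apply MvPolynomial.ringHom_ext
      · intro r; simp
      · intro w
        simp only [θ, AlgHom.toRingHom_eq_coe, RingHom.comp_apply, RingHom.coe_coe, aeval_X,
          map_sum, constantCoeff_X]
        refine Finset.sum_eq_zero fun k _ => ?_
        split_ifs <;> simp
    exact RingHom.congr_fun hc p
  · intro k hk
    simp only [dif_pos hk, AlgHom.toRingHom_eq_coe, RingHom.coe_coe, map_mul, aeval_X]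
    rw [hθ ⟨k, hk⟩ _ (Or.inl rfl), hθ ⟨k, hk⟩ _ (Or.inr rfl), hsq]
  · have hle : edgeIdeal K G ≤ Ideal.comap
        (aeval θ : MvPolynomial V K →ₐ[K] MvPolynomial ℕ K).toRingHom
        (sqI K {j | j < M.card}) := by
      unfold edgeIdeal
      rw [Ideal.span_le]
      rintro _ ⟨p, q, hpq, rfl⟩
      simp only [SetLike.mem_coe, Ideal.mem_comap, AlgHom.toRingHom_eq_coe, RingHom.coe_coe,
        map_mul, aeval_X]
      simp only [θ, Finset.sum_mul, Finset.mul_sum]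
      refine Ideal.sum_mem _ fun k _ => Ideal.sum_mem _ fun l _ => ?_
      split_ifs with h1 h2
      · by_cases hkl : k = l
        · subst hkl
          rw [hsq]
          exact sq_mem_sqI k.2
        · first
            | exact absurd hpq (hnadj k l hkl p q h1 h2)
            | exact absurd hpq (hnadj l k (Ne.symm hkl) p q h1 h2)
      all_goals simp
    exact fun p hp => hle hp

lemma edgeIdeal_ne_top {V : Type} (G : SimpleGraph V) : edgeIdeal K G ≠ ⊤ := by
  intro h
  have hle : edgeIdeal K G ≤ RingHom.ker (constantCoeff (σ := V) (R := K)) := by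
    unfold edgeIdeal
    rw [Ideal.span_le]
    rintro _ ⟨p, q, -, rfl⟩
    simp [RingHom.mem_ker]
  have h1 : (1 : MvPolynomial V K) ∈ edgeIdeal K G := by rw [h]; trivial
  have := hle h1
  rw [RingHom.mem_ker, map_one] at this
  exact one_ne_zero this

lemma final_bounds {V K : Type} [Field K] [Fintype V]
    (G : SimpleGraph V) (Hset T : Set V) (huni : Unicyclic (G.induce Hset))
    (at' : CliqueAttachment G Hset T) :
    (((inducedMatchingNumber G : ℤ)) : WithBot ℤ) ≤ regQuot (edgeIdeal K G) ∧
      regQuot (edgeIdeal K G) ≤ (((inducedMatchingNumber G : ℤ) + 1 : ℤ) : WithBot ℤ) := by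
  classical
  have hbdd : BddAbove { n | ∃ M, IsInducedMatchingSet G M ∧ M.card = n } := by
    refine ⟨Fintype.card (Sym2 V), ?_⟩
    rintro _ ⟨M, -, rfl⟩
    exact Finset.card_le_univ M
  have hne : { n | ∃ M, IsInducedMatchingSet G M ∧ M.card = n }.Nonempty :=
    ⟨0, ∅, ⟨⟨by simp, by simp [Set.Pairwise]⟩, by simp [Set.Pairwise]⟩, rfl⟩
  have hnu : NuLE G Set.univ (inducedMatchingNumber G) := by
    intro M hM _
    exact le_csSup hbdd ⟨M, hM, rfl⟩
  obtain ⟨M, hM, hMc⟩ := Nat.sSup_mem hne hbdd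
  change M.card = inducedMatchingNumber G at hMc
  obtain ⟨F, hF⟩ := exists_resolution (regI_main (K := K) huni at' hnu)
  have hF' : ((inducedMatchingNumber G : ℤ) + 1) ∈ { d : ℤ | ∃ F : GradedFreeResolution
      (edgeIdeal K G), ∀ i (k : Fin (F.rank i)), (F.deg i k : ℤ) ≤ d + i } := by
    refine ⟨F, ?_⟩
    intro i k
    cases i with
    | zero => rw [F.deg_zero]; push_cast; omega
    | succ i =>
      have := hF i k
      push_cast
      omega
  have hlow : ∀ d ∈ { d : ℤ | ∃ F : GradedFreeResolution
      (edgeIdeal K G), ∀ i (k : Fin (F.rank i)), (F.deg i k : ℤ) ≤ d + i },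
      (inducedMatchingNumber G : ℤ) ≤ d := by
    rintro d ⟨F, hF⟩
    obtain ⟨i, hi⟩ := lower_graph F hM
    have := hF _ i
    rw [hi, hMc] at this
    push_cast at this
    omega
  unfold regQuot
  rw [if_neg (edgeIdeal_ne_top G), WithBot.coe_le_coe, WithBot.coe_le_coe]
  exact ⟨le_csInf ⟨_, hF'⟩ hlow, csInf_le ⟨_, hlow⟩ hF'⟩

end Lower

end RegAux

open EdgeIdealReg in
/-- If `H` is unicyclic and `G = H_T` is obtained by attaching unions of complete graphs at
the vertices of `T ⊆ V(H)`, then `ν(G) ≤ reg(S/I(G)) ≤ ν(G) + 1`. -/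
theorem reg_unicyclic_attached_bounds {V K : Type} [Field K] [Fintype V] [DecidableEq V]
    (G : SimpleGraph V) (Hset T : Set V) (huni : Unicyclic (G.induce Hset))
    (hatt : Nonempty (CliqueAttachment G Hset T)) :
    (((inducedMatchingNumber G : ℤ)) : WithBot ℤ) ≤ regQuot (edgeIdeal K G) ∧
      regQuot (edgeIdeal K G) ≤ (((inducedMatchingNumber G : ℤ) + 1 : ℤ) : WithBot ℤ) := by
  obtain ⟨at'⟩ := hatt
  exact RegAux.final_bounds G Hset T huni at'
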